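/- arXiv:1408.3908 — 2 statements merged into one kernel-verified Lean document; each statement's English description precedes it below -/
import Mathlib

section
/- Let λ : ℕ → [0,∞) be a sequence, let m : [0,∞) → [0,∞) be continuous, let σ > 1/2 and δ > 0 be real numbers, and let (u⁰,u¹) ∈ D(A^{1/2}) × H (i.e. Σ_k (1+λ_k²)(u⁰_k)² < ∞ and Σ_k (u¹_k)² < ∞). Then there exists a global solution on [0,+∞) of the Kirchhoff equation u'' + 2δ A^σ u' + m(|A^{1/2}u|²) A u = 0 with initial data u(0)=u⁰, u'(0)=u¹, belonging to C⁰([0,+∞), D(A^{1/2})) ∩ C¹([0,+∞), H). -/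
open Set Filter MeasureTheory Topology

noncomputable section

/-- A continuity modulus: continuous on `[0,∞)`, vanishing at `0`, positive for positive
arguments, nondecreasing, and such that `x ↦ x / ω x` is nondecreasing on `(0,∞)`. -/
def IsModulus (ω : ℝ → ℝ) : Prop :=
  ContinuousOn ω (Ici 0) ∧ ω 0 = 0 ∧ (∀ x : ℝ, 0 < x → 0 < ω x) ∧
  (∀ x y : ℝ, 0 ≤ x → x ≤ y → ω x ≤ ω y) ∧
  (∀ x y : ℝ, 0 < x → x ≤ y → x / ω x ≤ y / ω y)

/-- The curve `t ↦ (v t k)_k` takes values in `ℓ²` and is continuous on `I`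
with respect to the `ℓ²` norm. -/
def L2Cont (I : Set ℝ) (v : ℝ → ℕ → ℝ) : Prop :=
  (∀ t ∈ I, Summable fun k => (v t k) ^ 2) ∧
  ∀ t ∈ I, ∀ ε : ℝ, 0 < ε → ∃ η > (0:ℝ), ∀ s ∈ I, |s - t| < η →
    (∑' k, (v s k - v t k) ^ 2) < ε

/-- A solution on the interval `I` (which contains `0`) of the Kirchhoff equation
`u'' + 2δ A^σ u' + m(|A^{1/2}u|²) A u = 0` with initial data `(u0, u1)`, in the diagonal
setting where `A` multiplies the `k`-th component by `lam k ^ 2`.  Each component is `C²`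
on `I`, satisfies the componentwise ODE, and the curves `t ↦ u(t)`, `t ↦ A^{1/2}u(t)`,
`t ↦ u'(t)` are continuous with values in `ℓ²`. -/
def IsKirchhoffSol (lam : ℕ → ℝ) (m : ℝ → ℝ) (σ δ : ℝ) (I : Set ℝ)
    (u0 u1 : ℕ → ℝ) (u : ℕ → ℝ → ℝ) : Prop :=
  (∀ k, ContDiffOn ℝ 2 (u k) I) ∧
  (∀ k, u k 0 = u0 k) ∧
  (∀ k, derivWithin (u k) I 0 = u1 k) ∧
  (∀ k, ∀ t ∈ I,
    derivWithin (derivWithin (u k) I) I t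
      + 2 * δ * lam k ^ (2 * σ) * derivWithin (u k) I t
      + m (∑' j, lam j ^ 2 * u j t ^ 2) * lam k ^ 2 * u k t = 0) ∧
  L2Cont I (fun t k => u k t) ∧
  L2Cont I (fun t k => lam k * u k t) ∧
  L2Cont I (fun t k => derivWithin (u k) I t)

/-- Smooth approximation of a continuous nonnegative function. -/
theorem exists_smooth_nonneg_near (f : ℝ → ℝ) (hf : Continuous f) (h0 : ∀ x, 0 ≤ f x)
    {ε : ℝ} (hε : 0 < ε) :
    ∃ g : ℝ → ℝ, ContDiff ℝ 1 g ∧ ∀ x, 0 ≤ g x ∧ |g x - f x| ≤ ε := by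
  obtain ⟨g, hg⟩ := exists_contMDiffMap_forall_mem_convex_of_local_const (n := 1)
    (modelWithCornersSelf ℝ ℝ) (t := fun x : ℝ => Ici 0 ∩ Icc (f x - ε) (f x + ε))
    (fun x => (convex_Ici 0).inter (convex_Icc _ _)) (fun x => ⟨f x, by
      have h1 : ∀ᶠ y in 𝓝 x, f y ∈ Metric.ball (f x) ε :=
        hf.continuousAt.eventually (Metric.ball_mem_nhds _ hε)
      filter_upwards [h1] with y hy
      rw [Metric.mem_ball, Real.dist_eq, abs_lt] at hy
      exact ⟨h0 x, by linarith, by linarith⟩⟩)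
  refine ⟨g, g.contMDiff.contDiff, fun x => ⟨(hg x).1, abs_le.2 ⟨?_, ?_⟩⟩⟩
  · linarith [(hg x).2.1]
  · linarith [(hg x).2.2]

theorem le_mul_exp_of_deriv_le {f f' : ℝ → ℝ} {T K : ℝ}
    (hf : ∀ t ∈ Icc 0 T, HasDerivWithinAt f (f' t) (Icc 0 T) t)
    (h : ∀ t ∈ Icc 0 T, f' t ≤ K * f t) :
    ∀ t ∈ Icc 0 T, f t ≤ f 0 * Real.exp (K * t) := by
  have := le_gronwallBound_of_liminf_deriv_right_le (f := f) (f' := f') (δ := f 0) (K := K)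
    (ε := 0) (a := 0) (b := T) (fun t ht => (hf t ht).continuousWithinAt)
    (fun x hx r hr => ((hf x (Ico_subset_Icc_self hx)).mono_of_mem_nhdsWithin
      (Icc_mem_nhdsGE_of_mem hx)).liminf_right_slope_le hr)
    le_rfl (fun x hx => by simpa using h x (Ico_subset_Icc_self hx))
  intro t ht
  simpa [gronwallBound_ε0] using this t ht

/-- Global existence for a locally Lipschitz vector field of linear growth. -/
theorem exists_integralCurve_of_linear_growth {ι : Type*} [Fintype ι]
    {f : (ι → ℝ) → (ι → ℝ)} (hf : ContDiff ℝ 1 f) {K : ℝ} (hK0 : 0 ≤ K)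
    (hK : ∀ y, ‖f y‖ ≤ K * ‖y‖) (y₀ : ι → ℝ) {T : ℝ} (hT : 0 ≤ T) :
    ∃ y : ℝ → ι → ℝ, y 0 = y₀ ∧
      ∀ t ∈ Icc 0 T, HasDerivWithinAt y (f (y t)) (Icc 0 T) t := by
  set ρ : ℝ := ‖y₀‖ * Real.exp (K * T)
  have hρ : 0 ≤ ρ := by positivity
  let P : (ι → ℝ) → (ι → ℝ) := fun y i => max (-ρ) (min ρ (y i))
  have hPabs : ∀ y i, |P y i| ≤ ρ ∧ |P y i| ≤ |y i| := by
    intro y i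
    constructor
    · exact abs_le.2 ⟨le_max_left _ _, max_le (by linarith) (min_le_left _ _)⟩
    · rcases abs_cases (y i) with ⟨h, h'⟩ | ⟨h, h'⟩
      · rw [h, abs_le]
        exact ⟨le_max_of_le_right (le_min (by linarith) (by linarith)),
          max_le (by linarith) (min_le_right _ _)⟩
      · rw [h, abs_le]
        exact ⟨le_max_of_le_right (le_min (by linarith) (by linarith)),
          max_le (by linarith) ((min_le_right _ _).trans (by linarith))⟩
  have hPρ : ∀ y, ‖P y‖ ≤ ρ := fun y =>
    (pi_norm_le_iff_of_nonneg hρ).2 fun i => (hPabs y i).1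
  have hPy : ∀ y, ‖P y‖ ≤ ‖y‖ := fun y =>
    (pi_norm_le_iff_of_nonneg (norm_nonneg _)).2 fun i =>
      (hPabs y i).2.trans (norm_le_pi_norm y i)
  have hPid : ∀ y : ι → ℝ, ‖y‖ ≤ ρ → P y = y := by
    intro y hy
    funext i
    have := abs_le.1 (((norm_le_pi_norm y i)).trans hy)
    simp only [P]
    rw [min_eq_right this.2, max_eq_right this.1]
  have hPlip : LipschitzWith 1 P := by
    refine LipschitzWith.of_dist_le_mul fun x y => ?_
    rw [NNReal.coe_one, one_mul]
    refine (dist_pi_le_iff dist_nonneg).2 fun i => ?_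
    refine le_trans ?_ (dist_le_pi_dist x y i)
    have h : LipschitzWith 1 fun z : ℝ => max (-ρ) (min ρ z) :=
      (LipschitzWith.id.const_min ρ).const_max (-ρ)
    simpa using h.dist_le_mul (x i) (y i)
  obtain ⟨C, hC⟩ := hf.contDiffOn.exists_lipschitzOnWith (s := Metric.closedBall 0 ρ) one_ne_zero
    (convex_closedBall _ _) (isCompact_closedBall _ _)
  have hlip : LipschitzWith (C * 1) (f ∘ P) := by
    rw [← lipschitzOnWith_univ]
    exact hC.comp hPlip.lipschitzOnWith fun y _ => by simpa using hPρ y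
  have hbd : ∀ y, ‖(f ∘ P) y‖ ≤ K * ρ := fun y =>
    (hK _).trans (mul_le_mul_of_nonneg_left (hPρ y) hK0)
  let a : NNReal := ⟨K * ρ * T, by positivity⟩
  let M : NNReal := ⟨K * ρ, by positivity⟩
  have hPL : IsPicardLindelof (fun _ : ℝ => f ∘ P) (tmin := 0) (tmax := T)
      ⟨0, le_rfl, hT⟩ y₀ a 0 M (C * 1) :=
    IsPicardLindelof.of_time_independent (fun x _ => hbd x) hlip.lipschitzOnWith (by
      simp only [sub_zero, sub_self, max_eq_left hT, NNReal.coe_zero]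
      exact le_rfl)
  obtain ⟨y, hy0, hy⟩ := hPL.exists_eq_forall_mem_Icc_hasDerivWithinAt₀
  have hy0' : y 0 = y₀ := hy0
  refine ⟨y, hy0', fun t ht => ?_⟩
  have hg := norm_le_gronwallBound_of_norm_deriv_right_le (f := y)
    (f' := fun t => (f ∘ P) (y t)) (δ := ‖y₀‖) (K := K)
    (ε := 0) (a := 0) (b := T) (fun t ht => (hy t ht).continuousWithinAt)
    (fun x hx => (hy x (Ico_subset_Icc_self hx)).mono_of_mem_nhdsWithin
      (Icc_mem_nhdsGE_of_mem hx)) (by rw [hy0'])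
    (fun x _ => by
      rw [add_zero]
      exact (hK _).trans (mul_le_mul_of_nonneg_left (hPy _) hK0)) t ht
  rw [gronwallBound_ε0, sub_zero] at hg
  have hle : ‖y t‖ ≤ ρ := hg.trans <|
    mul_le_mul_of_nonneg_left (Real.exp_le_exp.2 (mul_le_mul_of_nonneg_left ht.2 hK0))
      (norm_nonneg _)
  have := hy t ht
  rwa [Function.comp, hPid _ hle] at this

/-- Solvability of the system truncated to the first `n` modes. -/
theorem exists_galerkin (lam b : ℕ → ℝ) {g : ℝ → ℝ} (hg : ContDiff ℝ 1 g) {M : ℝ}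
    (hM : ∀ x, |g x| ≤ M) (u0 u1 : ℕ → ℝ) (n : ℕ) {T : ℝ} (hT : 0 ≤ T) :
    ∃ U V : ℕ → ℝ → ℝ,
      (∀ k ∈ Finset.range n, U k 0 = u0 k ∧ V k 0 = u1 k ∧ ∀ t ∈ Icc 0 T,
        HasDerivWithinAt (U k) (V k t) (Icc 0 T) t ∧
        HasDerivWithinAt (V k) (-2 * b k * V k t -
          g (∑ j ∈ Finset.range n, lam j ^ 2 * U j t ^ 2) * lam k ^ 2 * U k t) (Icc 0 T) t) ∧
      ∀ k ∉ Finset.range n, ∀ t, U k t = 0 ∧ V k t = 0 := by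
  let X : (Fin n ⊕ Fin n → ℝ) → ℝ := fun y => ∑ j : Fin n, lam j ^ 2 * y (Sum.inl j) ^ 2
  let f : (Fin n ⊕ Fin n → ℝ) → (Fin n ⊕ Fin n → ℝ) := fun y =>
    Sum.elim (fun i => y (Sum.inr i))
      (fun i => -2 * b i * y (Sum.inr i) - g (X y) * lam i ^ 2 * y (Sum.inl i))
  have hX : ContDiff ℝ 1 X := by
    simp only [X]
    fun_prop
  have hf : ContDiff ℝ 1 f := by
    rw [contDiff_pi]
    rintro (i | i)
    · simp only [f, Sum.elim_inl]
      fun_prop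
    · simp only [f, Sum.elim_inr]
      have := hg.comp hX
      simp only [Function.comp_def] at this
      fun_prop
  have hM0 : 0 ≤ M := (abs_nonneg _).trans (hM 0)
  set K : ℝ := 1 + ∑ i : Fin n, (2 * |b i| + M * lam i ^ 2) with hKdef
  have hnn : ∀ i : Fin n, 0 ≤ 2 * |b i| + M * lam i ^ 2 := fun i => by positivity
  have hK0 : 0 ≤ K := by
    have := Finset.sum_nonneg fun i (_ : i ∈ Finset.univ) => hnn i
    linarith
  have hK : ∀ y, ‖f y‖ ≤ K * ‖y‖ := by
    intro y
    refine (pi_norm_le_iff_of_nonneg (by positivity)).2 ?_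
    rintro (i | i)
    · have h1 := norm_le_pi_norm y (Sum.inr i)
      have h2 := Finset.sum_nonneg fun i (_ : i ∈ Finset.univ) => hnn i
      have h3 : 1 * ‖y‖ ≤ K * ‖y‖ := by gcongr; linarith
      simp only [f, Sum.elim_inl]
      linarith
    · have h1 := norm_le_pi_norm y (Sum.inr i)
      have h2 := norm_le_pi_norm y (Sum.inl i)
      have h3 := Finset.single_le_sum (fun i _ => hnn i) (Finset.mem_univ i)
      simp only [f, Sum.elim_inr]
      calc ‖-2 * b i * y (Sum.inr i) - g (X y) * lam i ^ 2 * y (Sum.inl i)‖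
          ≤ ‖-2 * b i * y (Sum.inr i)‖ + ‖g (X y) * lam i ^ 2 * y (Sum.inl i)‖ := norm_sub_le _ _
        _ = 2 * |b i| * ‖y (Sum.inr i)‖ + |g (X y)| * lam i ^ 2 * ‖y (Sum.inl i)‖ := by
            simp
        _ ≤ 2 * |b i| * ‖y‖ + M * lam i ^ 2 * ‖y‖ := by
            have := hM (X y)
            gcongr
        _ = (2 * |b i| + M * lam i ^ 2) * ‖y‖ := by ring
        _ ≤ K * ‖y‖ := by gcongr; linarith
  obtain ⟨y, hy0, hy⟩ := exists_integralCurve_of_linear_growth hf hK0 hK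
    (Sum.elim (fun i => u0 i) (fun i => u1 i)) hT
  refine ⟨fun k t => if h : k < n then y t (Sum.inl ⟨k, h⟩) else 0,
    fun k t => if h : k < n then y t (Sum.inr ⟨k, h⟩) else 0, fun k hk => ?_, fun k hk t => ?_⟩
  · rw [Finset.mem_range] at hk
    simp only [hk, dif_pos, hy0, Sum.elim_inl, Sum.elim_inr, true_and]
    intro t ht
    have h := hasDerivWithinAt_pi.1 (hy t ht)
    refine ⟨h (Sum.inl ⟨k, hk⟩), ?_⟩
    have hs : ∑ j ∈ Finset.range n,
        lam j ^ 2 * (if h : j < n then y t (Sum.inl ⟨j, h⟩) else 0) ^ 2 = X (y t) := by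
      rw [Finset.sum_range]
      simp [X]
    rw [hs]
    exact h (Sum.inr ⟨k, hk⟩)
  · rw [Finset.mem_range] at hk
    simp [hk]

/-- Exponential energy estimate for a single mode, with a rate depending on the frequency. -/
theorem mode_energy_le_exp {l b B T : ℝ} (hb : 0 ≤ b) {u v c : ℝ → ℝ}
    (hu : ∀ t ∈ Icc 0 T, HasDerivWithinAt u (v t) (Icc 0 T) t)
    (hv : ∀ t ∈ Icc 0 T,
      HasDerivWithinAt v (-2 * b * v t - c t * l ^ 2 * u t) (Icc 0 T) t)
    (hc : ∀ t ∈ Icc 0 T, 0 ≤ c t ∧ c t ≤ B) :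
    ∀ t ∈ Icc 0 T, (1 + l ^ 2) * u t ^ 2 + v t ^ 2 ≤
      ((1 + l ^ 2) * u 0 ^ 2 + v 0 ^ 2) * Real.exp ((1 + l ^ 2 + B * l ^ 2) * t) := by
  refine le_mul_exp_of_deriv_le (f := fun t => (1 + l ^ 2) * u t ^ 2 + v t ^ 2)
    (f' := fun t => 2 * (1 + l ^ 2) * u t * v t +
      2 * v t * (-2 * b * v t - c t * l ^ 2 * u t)) (fun t ht => ?_) (fun t ht => ?_)
  · refine ((((hu t ht).pow 2).const_mul (1 + l ^ 2)).add ((hv t ht).pow 2)).congr_deriv ?_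
    ring
  · obtain ⟨h0, hB⟩ := hc t ht
    have hl := sq_nonneg l
    have h1 : 0 ≤ b * v t ^ 2 := by positivity
    have h2 : 2 * (u t * v t) ≤ u t ^ 2 + v t ^ 2 := by nlinarith [sq_nonneg (u t - v t)]
    have h3 : -(2 * (u t * v t)) ≤ u t ^ 2 + v t ^ 2 := by nlinarith [sq_nonneg (u t + v t)]
    have h4 : (1 + l ^ 2) * (2 * (u t * v t)) ≤ (1 + l ^ 2) * (u t ^ 2 + v t ^ 2) := by gcongr
    have h5 : c t * l ^ 2 * (-(2 * (u t * v t))) ≤ B * l ^ 2 * (u t ^ 2 + v t ^ 2) :=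
      (mul_le_mul_of_nonneg_left h3 (by positivity)).trans (by gcongr)
    have hB0 := h0.trans hB
    have h6 : 0 ≤ (1 + l ^ 2 + B * l ^ 2) * (l ^ 2 * u t ^ 2) := by positivity
    nlinarith

/-- Energy estimate for an overdamped mode, with a constant independent of the frequency. -/
theorem mode_energy_le_of_overdamped {l b B T : ℝ} (hl : 1 ≤ l) (hb : 0 < b) (hB : 1 ≤ B)
    (hBb : B * l ^ 2 ≤ 2 * b ^ 2) {u v c : ℝ → ℝ}
    (hu : ∀ t ∈ Icc 0 T, HasDerivWithinAt u (v t) (Icc 0 T) t)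
    (hv : ∀ t ∈ Icc 0 T,
      HasDerivWithinAt v (-2 * b * v t - c t * l ^ 2 * u t) (Icc 0 T) t)
    (hc : ∀ t ∈ Icc 0 T, 0 ≤ c t ∧ c t ≤ B) :
    ∀ t ∈ Icc 0 T, (1 + l ^ 2) * u t ^ 2 + v t ^ 2 ≤
      10 * B * ((1 + l ^ 2) * u 0 ^ 2 + v 0 ^ 2) := by
  have hmono := le_mul_exp_of_deriv_le (K := 0) (T := T)
    (f := fun t => B * l ^ 2 * (v t ^ 2 + 2 * b * (u t * v t) + 2 * b ^ 2 * u t ^ 2) +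
      b ^ 2 * v t ^ 2)
    (f' := fun t => -(B * l ^ 2 * (2 * b * v t ^ 2 + 2 * b * (c t * l ^ 2) * u t ^ 2
      + 2 * (c t * l ^ 2) * (u t * v t))) + b ^ 2 * (2 * v t * (-2 * b * v t - c t * l ^ 2 * u t)))
    (fun t ht => by
      refine ((((((hv t ht).pow 2).add (((hu t ht).mul (hv t ht)).const_mul (2 * b))).add
        (((hu t ht).pow 2).const_mul (2 * b ^ 2))).const_mul (B * l ^ 2)).add
        (((hv t ht).pow 2).const_mul (b ^ 2))).congr_deriv ?_
      ring)
    (fun t ht => by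
      obtain ⟨h0, hB'⟩ := hc t ht
      set d := c t * l ^ 2 with hd
      have hd0 : 0 ≤ d := by positivity
      have hdB : d ≤ B * l ^ 2 := mul_le_mul_of_nonneg_right hB' (sq_nonneg l)
      have h1 : 0 ≤ 2 * b * v t ^ 2 + b * d * u t ^ 2 + 2 * d * (u t * v t) := by
        have : 0 ≤ b * (2 * b * v t ^ 2 + b * d * u t ^ 2 + 2 * d * (u t * v t)) := by
          nlinarith [sq_nonneg (2 * b * v t + d * u t),
            mul_nonneg (mul_nonneg hd0 (sub_nonneg.2 (hdB.trans hBb))) (sq_nonneg (u t))]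
        exact nonneg_of_mul_nonneg_right this hb
      have h2 : 0 ≤ b * (4 * b ^ 2 * v t ^ 2 + 2 * b * d * (u t * v t) + d ^ 2 * u t ^ 2) :=
        mul_nonneg hb.le <| by
          nlinarith [sq_nonneg (2 * b * v t + d * u t / 2), sq_nonneg (d * u t)]
      have h3 : b * (d * d) * u t ^ 2 ≤ b * (B * l ^ 2 * d) * u t ^ 2 := by gcongr
      have h4 := mul_nonneg (by positivity : 0 ≤ B * l ^ 2) h1
      nlinarith)
  intro t ht
  have h := hmono t ht
  simp only [zero_mul, Real.exp_zero, mul_one] at h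
  have hu0 : 2 * (u 0 * v 0) * b ≤ v 0 ^ 2 + b ^ 2 * u 0 ^ 2 := by
    nlinarith [sq_nonneg (v 0 - b * u 0)]
  have hBl : 0 ≤ B * l ^ 2 := by positivity
  have h1 : b ^ 2 * (B * l ^ 2 * u t ^ 2 + v t ^ 2) ≤
      b ^ 2 * (3 * (B * l ^ 2) * u 0 ^ 2 + 5 * v 0 ^ 2) := by
    have e1 := mul_nonneg hBl (sq_nonneg (v t + b * u t))
    have e2 := mul_le_mul_of_nonneg_left hu0 hBl
    have e3 := mul_le_mul_of_nonneg_right hBb (sq_nonneg (v 0))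
    nlinarith
  have h2 := le_of_mul_le_mul_left h1 (by positivity)
  have h3 : (1 + l ^ 2) * u t ^ 2 ≤ 2 * (B * l ^ 2 * u t ^ 2) := by
    have : 1 + l ^ 2 ≤ 2 * (B * l ^ 2) := by nlinarith
    nlinarith [mul_le_mul_of_nonneg_right this (sq_nonneg (u t))]
  have h4 : v 0 ^ 2 ≤ B * v 0 ^ 2 := le_mul_of_one_le_left (sq_nonneg _) hB
  have h5 : 0 ≤ B * u 0 ^ 2 := by positivity
  have h6 : 0 ≤ B * l ^ 2 * u 0 ^ 2 := by positivity
  have h7 := sq_nonneg (v t)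
  nlinarith

/-- In the supercritical regime the energy of each mode is controlled uniformly with respect to
the frequency, once the coefficient is bounded. -/
theorem exists_mode_energy_bound {σ δ : ℝ} (hσ : 1 / 2 < σ) (hδ : 0 < δ) (B T : ℝ) :
    ∃ K : ℝ, 0 ≤ K ∧ ∀ l : ℝ, 0 ≤ l → ∀ u v c : ℝ → ℝ,
      (∀ t ∈ Icc 0 T, HasDerivWithinAt u (v t) (Icc 0 T) t) →
      (∀ t ∈ Icc 0 T, HasDerivWithinAt v
        (-2 * (δ * l ^ (2 * σ)) * v t - c t * l ^ 2 * u t) (Icc 0 T) t) →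
      (∀ t ∈ Icc 0 T, 0 ≤ c t ∧ c t ≤ B) →
      ∀ t ∈ Icc 0 T, (1 + l ^ 2) * u t ^ 2 + v t ^ 2 ≤
        K * ((1 + l ^ 2) * u 0 ^ 2 + v 0 ^ 2) := by
  wlog hB : 1 ≤ B generalizing B
  · obtain ⟨K, hK0, hK⟩ := this 1 le_rfl
    exact ⟨K, hK0, fun l hl u v c hu hv hc =>
      hK l hl u v c hu hv fun t ht => ⟨(hc t ht).1, (hc t ht).2.trans (not_le.1 hB).le⟩⟩
  have hlim : Tendsto (fun l : ℝ => l ^ (4 * σ - 2)) atTop atTop :=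
    tendsto_rpow_atTop (by linarith)
  obtain ⟨Λ, hΛ1, hΛ⟩ : ∃ Λ : ℝ, 1 ≤ Λ ∧ ∀ l, Λ ≤ l → B / (2 * δ ^ 2) ≤ l ^ (4 * σ - 2) := by
    obtain ⟨Λ, hΛ⟩ := eventually_atTop.1 (hlim.eventually_ge_atTop (B / (2 * δ ^ 2)))
    exact ⟨max 1 Λ, le_max_left _ _, fun l hl => hΛ l ((le_max_right _ _).trans hl)⟩
  refine ⟨max (Real.exp ((1 + Λ ^ 2 + B * Λ ^ 2) * T)) (10 * B),
    le_max_of_le_left (Real.exp_nonneg _), fun l hl u v c hu hv hc t ht => ?_⟩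
  have hb : 0 ≤ δ * l ^ (2 * σ) := by positivity
  have hE : 0 ≤ (1 + l ^ 2) * u 0 ^ 2 + v 0 ^ 2 := by positivity
  rcases le_total l Λ with hle | hle
  · refine (mode_energy_le_exp hb hu hv hc t ht).trans ?_
    rw [mul_comm]
    refine mul_le_mul_of_nonneg_right (le_max_of_le_left (Real.exp_le_exp.2 ?_)) hE
    have := ht.1
    have := ht.2
    gcongr
  · have hl1 : 1 ≤ l := hΛ1.trans hle
    have hl0 : 0 < l := by linarith
    have hBb : B * l ^ 2 ≤ 2 * (δ * l ^ (2 * σ)) ^ 2 := by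
      have h1 := hΛ l hle
      rw [div_le_iff₀ (by positivity)] at h1
      have h2 : (l ^ (2 * σ)) ^ 2 = l ^ (4 * σ - 2) * l ^ 2 := by
        rw [← Real.rpow_natCast (l ^ (2 * σ)) 2, ← Real.rpow_mul hl, ← Real.rpow_natCast l 2,
          ← Real.rpow_add hl0]
        norm_num
        ring_nf
      rw [mul_pow, h2]
      calc B * l ^ 2 ≤ l ^ (4 * σ - 2) * (2 * δ ^ 2) * l ^ 2 := by gcongr
        _ = _ := by ring
    refine (mode_energy_le_of_overdamped hl1 (by positivity) hB hBb hu hv hc t ht).trans ?_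
    exact mul_le_mul_of_nonneg_right (le_max_right _ _) hE

/-- The `A^{1/2}` norm of a Galerkin approximation is bounded independently of the number of modes
and of the nonlinearity, through the initial energy. -/
theorem galerkin_energy_bound {lam b u0 u1 : ℕ → ℝ} {δ T : ℝ} (hδ : 0 < δ)
    (hlam : ∀ k, 0 ≤ lam k) (hb : ∀ k, 0 ≤ b k) (hlb : ∀ k, 1 < lam k → δ * lam k ≤ b k)
    {g : ℝ → ℝ} (hg : Continuous g) (hg0 : ∀ x, 0 ≤ g x) {s : Finset ℕ} {U V : ℕ → ℝ → ℝ}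
    (hU : ∀ k ∈ s, U k 0 = u0 k ∧ V k 0 = u1 k ∧ ∀ t ∈ Icc 0 T,
        HasDerivWithinAt (U k) (V k t) (Icc 0 T) t ∧
        HasDerivWithinAt (V k) (-2 * b k * V k t -
          g (∑ j ∈ s, lam j ^ 2 * U j t ^ 2) * lam k ^ 2 * U k t) (Icc 0 T) t) :
    ∀ t ∈ Icc 0 T, ∑ j ∈ s, lam j ^ 2 * U j t ^ 2 ≤
      2 * ((∑ j ∈ s, (2 * ((1 + lam j ^ 2) * u0 j ^ 2) + 2 / δ ^ 2 * u1 j ^ 2)) +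
        (∫ x in (0:ℝ)..(∑ j ∈ s, lam j ^ 2 * u0 j ^ 2), g x) / δ ^ 2) *
        Real.exp ((1 + 2 * δ ^ 2) * T) := by
  intro t ht
  set X : ℝ → ℝ := fun t => ∑ j ∈ s, lam j ^ 2 * U j t ^ 2 with hXdef
  let w : ℕ → ℝ → ℝ := fun k t => if lam k ≤ 1 then U k t ^ 2 else
    lam k ^ 2 / b k * (U k t * V k t) + lam k ^ 2 * U k t ^ 2
  let w' : ℕ → ℝ → ℝ := fun k t => if lam k ≤ 1 then 2 * (U k t * V k t) else
    lam k ^ 2 / b k * (V k t ^ 2 - g (X t) * lam k ^ 2 * U k t ^ 2)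
  have hw : ∀ k ∈ s, ∀ t ∈ Icc 0 T, HasDerivWithinAt (w k) (w' k t) (Icc 0 T) t := by
    intro k hk t ht
    obtain ⟨hu, hv⟩ := (hU k hk).2.2 t ht
    by_cases hl : lam k ≤ 1
    · simp only [w, w', hl, if_true]
      refine (hu.pow 2).congr_deriv ?_
      ring
    · have hb' : b k ≠ 0 := by
        have := hlb k (not_le.1 hl)
        have : 0 < δ * lam k := mul_pos hδ (by linarith)
        linarith
      simp only [w, w', hl, if_false]
      refine (((hu.mul hv).const_mul (lam k ^ 2 / b k)).add
        ((hu.pow 2).const_mul (lam k ^ 2))).congr_deriv ?_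
      field_simp
      ring
  have hr : ∀ k, 1 < lam k → 0 ≤ lam k ^ 2 / b k ∧ lam k ^ 2 / b k * δ ≤ lam k ∧
      lam k ^ 2 / b k ≤ b k / δ ^ 2 := by
    intro k hk
    have h1 := hlb k hk
    have h2 : 0 < lam k := by linarith
    have h3 : 0 < b k := lt_of_lt_of_le (by positivity) h1
    refine ⟨by positivity, ?_, ?_⟩
    · rw [div_mul_eq_mul_div, div_le_iff₀ h3]
      nlinarith
    · rw [div_le_div_iff₀ h3 (by positivity), ← sq, ← mul_pow, mul_comm]
      gcongr
  have hcross : ∀ k, 1 < lam k → ∀ x y : ℝ,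
      |lam k ^ 2 / b k * (x * y)| ≤ lam k ^ 2 * x ^ 2 / 2 + y ^ 2 / δ ^ 2 / 2 := by
    intro k hk x y
    obtain ⟨h1, h2, -⟩ := hr k hk
    have h3 : lam k ^ 2 / b k * (x * y) = lam k ^ 2 / b k * δ * (x * (y / δ)) := by
      field_simp
    rw [h3, abs_mul, abs_of_nonneg (by positivity), abs_mul, ← div_pow, ← sq_abs x,
      ← sq_abs (y / δ)]
    have h4 : lam k ^ 2 / b k * δ * (|x| * |y / δ|) ≤ lam k * (|x| * |y / δ|) := by gcongr
    nlinarith [sq_nonneg (lam k * |x| - |y / δ|)]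
  have hwge : ∀ k ∈ s, ∀ t, lam k ^ 2 * U k t ^ 2 / 2 ≤ w k t + V k t ^ 2 / δ ^ 2 := by
    intro k _ t
    have hp : 0 ≤ V k t ^ 2 / δ ^ 2 := by positivity
    by_cases hl : lam k ≤ 1
    · simp only [w, hl, if_true]
      have : lam k ^ 2 ≤ 1 := pow_le_one₀ (hlam k) hl
      nlinarith [mul_le_mul_of_nonneg_right this (sq_nonneg (U k t))]
    · simp only [w, hl, if_false]
      have := (abs_le.1 (hcross k (not_le.1 hl) (U k t) (V k t))).1
      linarith
  have hw'le : ∀ k ∈ s, ∀ t, w' k t - 4 / δ ^ 2 * b k * V k t ^ 2 ≤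
      (1 + 2 * δ ^ 2) * (w k t + V k t ^ 2 / δ ^ 2) := by
    intro k hk t
    by_cases hl : lam k ≤ 1
    · simp only [w, w', hl, if_true]
      have h1 : 0 ≤ 4 / δ ^ 2 * b k * V k t ^ 2 := by
        have := hb k
        positivity
      have h2 : (1 + 2 * δ ^ 2) * (U k t ^ 2 + V k t ^ 2 / δ ^ 2) =
          U k t ^ 2 + 2 * δ ^ 2 * U k t ^ 2 + V k t ^ 2 / δ ^ 2 + 2 * V k t ^ 2 := by
        field_simp
        ring
      have h3 : 0 ≤ V k t ^ 2 / δ ^ 2 := by positivity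
      have h4 : 0 ≤ 2 * δ ^ 2 * U k t ^ 2 := by positivity
      nlinarith [sq_nonneg (U k t - V k t)]
    · have h0 : 0 ≤ (1 + 2 * δ ^ 2) * (w k t + V k t ^ 2 / δ ^ 2) :=
        mul_nonneg (by positivity) (le_trans (by positivity) (hwge k hk t))
      refine le_trans ?_ h0
      simp only [w', hl, if_false]
      obtain ⟨h1, -, h3⟩ := hr k (not_le.1 hl)
      have h4 : 0 ≤ lam k ^ 2 / b k * (g (X t) * lam k ^ 2 * U k t ^ 2) := by
        have := hg0 (X t)
        positivity
      have h5 : lam k ^ 2 / b k * V k t ^ 2 ≤ b k / δ ^ 2 * V k t ^ 2 := by gcongr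
      have h6 : 0 ≤ b k / δ ^ 2 * V k t ^ 2 := by
        have := hb k
        positivity
      have h7 : 4 / δ ^ 2 * b k * V k t ^ 2 = 4 * (b k / δ ^ 2 * V k t ^ 2) := by ring
      rw [h7]
      linarith
  have hwle : ∀ k ∈ s, w k 0 + V k 0 ^ 2 / δ ^ 2 ≤
      2 * ((1 + lam k ^ 2) * u0 k ^ 2) + 2 / δ ^ 2 * u1 k ^ 2 := by
    intro k hk
    have e : 2 / δ ^ 2 * u1 k ^ 2 = 2 * (u1 k ^ 2 / δ ^ 2) := by ring
    have hp : 0 ≤ u1 k ^ 2 / δ ^ 2 := by positivity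
    have h1 := sq_nonneg (u0 k)
    have h2 : 0 ≤ lam k ^ 2 * u0 k ^ 2 := by positivity
    rw [e, (hU k hk).2.1]
    by_cases hl : lam k ≤ 1
    · simp only [w, hl, if_true]
      rw [(hU k hk).1]
      linarith
    · simp only [w, hl, if_false]
      rw [(hU k hk).1, (hU k hk).2.1]
      have := (abs_le.1 (hcross k (not_le.1 hl) (u0 k) (u1 k))).2
      linarith
  let G : ℝ → ℝ := fun x => ∫ y in (0:ℝ)..x, g y
  have hG : ∀ x, HasDerivAt G (g x) x := fun x => (hg.integral_hasStrictDerivAt 0 x).hasDerivAt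
  have hX0 : ∀ t, 0 ≤ X t := fun t => Finset.sum_nonneg fun j _ => by positivity
  have hG0 : ∀ x, 0 ≤ x → 0 ≤ G x := fun x hx =>
    intervalIntegral.integral_nonneg hx fun y _ => hg0 y
  let W : ℝ → ℝ := fun t => (∑ k ∈ s, (w k t + V k t ^ 2 / δ ^ 2)) + G (X t) / δ ^ 2
  let X' : ℝ → ℝ := fun t => ∑ j ∈ s, lam j ^ 2 * (2 * U j t * V j t)
  have hX : ∀ t ∈ Icc 0 T, HasDerivWithinAt X (X' t) (Icc 0 T) t := by
    intro t ht
    refine HasDerivWithinAt.fun_sum fun j hj => ?_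
    refine ((((hU j hj).2.2 t ht).1.pow 2).const_mul (lam j ^ 2)).congr_deriv ?_
    ring
  have hW : ∀ t ∈ Icc 0 T, HasDerivWithinAt W
      ((∑ k ∈ s, (w' k t + 2 * V k t * (-2 * b k * V k t -
          g (X t) * lam k ^ 2 * U k t) / δ ^ 2)) + g (X t) * X' t / δ ^ 2) (Icc 0 T) t := by
    intro t ht
    refine (HasDerivWithinAt.fun_sum fun k hk => ?_).add
      (((hG (X t)).comp_hasDerivWithinAt t (hX t ht)).div_const _)
    refine ((hw k hk t ht).add ((((hU k hk).2.2 t ht).2.pow 2).div_const _)).congr_deriv ?_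
    ring
  have hgron := le_mul_exp_of_deriv_le (K := 1 + 2 * δ ^ 2) hW (fun t ht => by
    have e : (∑ k ∈ s, (w' k t + 2 * V k t * (-2 * b k * V k t -
          g (X t) * lam k ^ 2 * U k t) / δ ^ 2)) + g (X t) * X' t / δ ^ 2 =
        ∑ k ∈ s, (w' k t - 4 / δ ^ 2 * b k * V k t ^ 2) := by
      simp only [X']
      rw [mul_div_right_comm, Finset.mul_sum, ← Finset.sum_add_distrib]
      refine Finset.sum_congr rfl fun k _ => ?_
      ring
    rw [e]
    simp only [W]
    rw [mul_add, Finset.mul_sum]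
    have h1 : 0 ≤ (1 + 2 * δ ^ 2) * (G (X t) / δ ^ 2) := by
      have := hG0 _ (hX0 t)
      positivity
    have h2 := Finset.sum_le_sum fun k hk => hw'le k hk t
    linarith) t ht
  have hW0 : 0 ≤ W 0 := by
    have h1 : 0 ≤ G (X 0) / δ ^ 2 := div_nonneg (hG0 _ (hX0 0)) (sq_nonneg _)
    refine add_nonneg (Finset.sum_nonneg fun k hk => ?_) h1
    exact le_trans (by positivity) (hwge k hk 0)
  have hXW : X t ≤ 2 * W t := by
    have h1 : 0 ≤ G (X t) / δ ^ 2 := div_nonneg (hG0 _ (hX0 t)) (sq_nonneg _)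
    have h2 := Finset.sum_le_sum fun k hk => hwge k hk t
    rw [← Finset.sum_div] at h2
    simp only [W]
    simp only [hXdef] at h1 ⊢
    linarith
  have hX00 : X 0 = ∑ j ∈ s, lam j ^ 2 * u0 j ^ 2 :=
    Finset.sum_congr rfl fun j hj => by rw [(hU j hj).1]
  have hW00 : W 0 ≤ (∑ j ∈ s, (2 * ((1 + lam j ^ 2) * u0 j ^ 2) + 2 / δ ^ 2 * u1 j ^ 2)) +
        G (∑ j ∈ s, lam j ^ 2 * u0 j ^ 2) / δ ^ 2 := by
    simp only [W, hX00]
    exact add_le_add (Finset.sum_le_sum hwle) le_rfl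
  calc X t ≤ 2 * W t := hXW
    _ ≤ 2 * (W 0 * Real.exp ((1 + 2 * δ ^ 2) * t)) := by gcongr
    _ ≤ 2 * (W 0 * Real.exp ((1 + 2 * δ ^ 2) * T)) := by
        have := ht.2
        gcongr
    _ ≤ 2 * (((∑ j ∈ s, (2 * ((1 + lam j ^ 2) * u0 j ^ 2) + 2 / δ ^ 2 * u1 j ^ 2)) +
        G (∑ j ∈ s, lam j ^ 2 * u0 j ^ 2) / δ ^ 2) * Real.exp ((1 + 2 * δ ^ 2) * T)) := by gcongr
    _ = _ := by rw [← mul_assoc]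

theorem continuousOn_Ici_of_Icc {f : ℝ → ℝ} (h : ∀ T : ℝ, ContinuousOn f (Icc 0 T)) :
    ContinuousOn f (Ici 0) := by
  intro t ht
  refine (h (t + 1) t ⟨ht, by linarith⟩).mono_of_mem_nhdsWithin ?_
  exact mem_nhdsWithin.2 ⟨Iio (t + 1), isOpen_Iio, by simp, fun x hx => ⟨hx.2, hx.1.le⟩⟩

/-- A sequence of countable families of locally bounded, locally equi-Lipschitz functions on the
half line has a pointwise convergent subsequence, with continuous limits. -/
theorem exists_subseq_tendsto_of_equiLipschitz {ι : Type*} [Countable ι] {F : ℕ → ι → ℝ → ℝ}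
    (hF : ∀ i (T : ℝ), ∃ B L : ℝ, 0 ≤ B ∧ 0 ≤ L ∧ ∀ᶠ n in atTop, ∀ t ∈ Icc 0 T,
      |F n i t| ≤ B ∧ ∀ s ∈ Icc 0 T, |F n i t - F n i s| ≤ L * |t - s|) :
    ∃ φ : ℕ → ℕ, StrictMono φ ∧ ∃ f : ι → ℝ → ℝ,
      (∀ i, ∀ t ∈ Ici (0:ℝ), Tendsto (fun n => F (φ n) i t) atTop (𝓝 (f i t))) ∧
      ∀ i, ContinuousOn (f i) (Ici 0) := by
  choose B L hB hL hF using hF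
  let G : ℕ → ι × ℚ → ℝ := fun n p => max (-(B p.1 p.2)) (min (B p.1 p.2) (F n p.1 p.2))
  obtain ⟨a, -, φ, hφ, ha⟩ := (isCompact_univ_pi fun p : ι × ℚ =>
    isCompact_Icc (a := -(B p.1 p.2)) (b := B p.1 p.2)).tendsto_subseq (x := G) (fun n p _ =>
      ⟨le_max_left _ _, max_le (by linarith [hB p.1 p.2]) (min_le_left _ _)⟩)
  rw [tendsto_pi_nhds] at ha
  have hrat : ∀ i (q : ℚ), 0 ≤ (q : ℝ) → CauchySeq fun n => F (φ n) i q := by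
    intro i q hq
    refine Tendsto.cauchySeq (x := a (i, q)) ((ha (i, q)).congr' ?_)
    filter_upwards [hφ.tendsto_atTop.eventually (hF i q)] with n hn
    have := abs_le.1 (hn q ⟨hq, le_rfl⟩).1
    simp only [Function.comp, G]
    rw [min_eq_right this.2, max_eq_right this.1]
  have hcau : ∀ i, ∀ t ∈ Ici (0:ℝ), ∃ x, Tendsto (fun n => F (φ n) i t) atTop (𝓝 x) := by
    intro i t ht
    refine cauchySeq_tendsto_of_complete (Metric.cauchySeq_iff.2 fun ε hε => ?_)
    have hLp : 0 < L i (t + 1) + 1 := by linarith [hL i (t + 1)]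
    obtain ⟨q, hq1, hq2⟩ := exists_rat_btwn
      (show t < t + min 1 (ε / (3 * (L i (t + 1) + 1))) by
        have : 0 < min 1 (ε / (3 * (L i (t + 1) + 1))) := by positivity
        linarith)
    have ht0 : 0 ≤ t := ht
    have hq3 : (q : ℝ) ≤ t + 1 := by linarith [min_le_left 1 (ε / (3 * (L i (t + 1) + 1)))]
    have hq4 : L i (t + 1) * |t - q| < ε / 3 := by
      rw [abs_sub_comm, abs_of_nonneg (by linarith)]
      have h1 : (q : ℝ) - t < ε / (3 * (L i (t + 1) + 1)) := by
        linarith [min_le_right 1 (ε / (3 * (L i (t + 1) + 1)))]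
      rw [lt_div_iff₀ (by positivity)] at h1
      nlinarith [hL i (t + 1)]
    obtain ⟨N₁, hN₁⟩ := Metric.cauchySeq_iff.1 (hrat i q (by linarith)) (ε / 3) (by positivity)
    obtain ⟨N₂, hN₂⟩ := eventually_atTop.1 (hφ.tendsto_atTop.eventually (hF i (t + 1)))
    refine ⟨max N₁ N₂, fun m hm n hn => ?_⟩
    have e1 := (hN₂ m ((le_max_right _ _).trans hm) t ⟨ht0, by linarith⟩).2 q
      ⟨by linarith, hq3⟩
    have e2 := (hN₂ n ((le_max_right _ _).trans hn) t ⟨ht0, by linarith⟩).2 q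
      ⟨by linarith, hq3⟩
    have e3 := hN₁ m ((le_max_left _ _).trans hm) n ((le_max_left _ _).trans hn)
    rw [Real.dist_eq, abs_lt] at e3
    have e1 := abs_le.1 (e1.trans hq4.le)
    have e2 := abs_le.1 (e2.trans hq4.le)
    rw [Real.dist_eq, abs_lt]
    constructor <;> linarith
  refine ⟨φ, hφ, fun i t => if h : t ∈ Ici (0:ℝ) then (hcau i t h).choose else 0, ?_, ?_⟩
  · intro i t ht
    simp only [ht, dif_pos]
    exact (hcau i t ht).choose_spec
  · intro i
    set f : ℝ → ℝ := fun t => if h : t ∈ Ici (0:ℝ) then (hcau i t h).choose else 0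
    have hf : ∀ t ∈ Ici (0:ℝ), Tendsto (fun n => F (φ n) i t) atTop (𝓝 (f t)) := by
      intro t ht
      simp only [f, ht, dif_pos]
      exact (hcau i t ht).choose_spec
    have hlip : ∀ T : ℝ, LipschitzOnWith (L i T).toNNReal f (Icc 0 T) := by
      intro T
      refine LipschitzOnWith.of_dist_le_mul fun t ht s hs => ?_
      rw [Real.coe_toNNReal _ (hL i T), Real.dist_eq, Real.dist_eq]
      refine le_of_tendsto ((hf t ht.1).sub (hf s hs.1)).abs ?_
      filter_upwards [hφ.tendsto_atTop.eventually (hF i T)] with n hn using (hn t ht).2 s hs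
    exact continuousOn_Ici_of_Icc fun T => (hlip T).continuousOn

/-- Componentwise continuity and local domination by a summable sequence give continuity in the
`ℓ²` norm. -/
theorem l2Cont_of_dominated {v : ℝ → ℕ → ℝ} (hv : ∀ k, ContinuousOn (fun t => v t k) (Ici 0))
    (hd : ∀ T : ℝ, ∃ g : ℕ → ℝ, Summable g ∧ ∀ k, ∀ t ∈ Icc 0 T, v t k ^ 2 ≤ g k) :
    L2Cont (Ici 0) v := by
  constructor
  · intro t ht
    obtain ⟨g, hg, hvg⟩ := hd t
    exact Summable.of_nonneg_of_le (fun k => sq_nonneg _) (fun k => hvg k t ⟨ht, le_rfl⟩) hg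
  · intro t ht ε hε
    have ht0 : 0 ≤ t := ht
    have hcont : ContinuousOn (fun s => ∑' k, (v s k - v t k) ^ 2) (Ici 0) := by
      refine continuousOn_Ici_of_Icc fun T => ?_
      obtain ⟨g, hg, hvg⟩ := hd (max t T)
      refine continuousOn_tsum (u := fun k => 4 * g k)
        (fun k => (((hv k).mono Icc_subset_Ici_self).sub continuousOn_const).pow 2)
        (hg.mul_left 4) (fun k s hs => ?_)
      have h1 := hvg k s ⟨hs.1, hs.2.trans (le_max_right _ _)⟩
      have h2 := hvg k t ⟨ht0, le_max_left _ _⟩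
      rw [Real.norm_of_nonneg (sq_nonneg _)]
      nlinarith [sq_nonneg (v s k + v t k)]
    obtain ⟨η, hη, h⟩ := Metric.continuousWithinAt_iff.1 (hcont t ht) ε hε
    refine ⟨η, hη, fun s hs hst => ?_⟩
    have := h hs (by rwa [Real.dist_eq])
    simp only [sub_self, ne_eq, OfNat.ofNat_ne_zero, not_false_eq_true, zero_pow, tsum_zero,
      Real.dist_eq, sub_zero] at this
    exact (le_abs_self _).trans_lt this

theorem hasDerivWithinAt_add_integral {f : ℝ → ℝ} (hf : ContinuousOn f (Ici 0)) (a : ℝ)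
    {F : ℝ → ℝ} (hF : ∀ t ∈ Ici (0:ℝ), F t = a + ∫ s in (0:ℝ)..t, f s) :
    ∀ t ∈ Ici (0:ℝ), HasDerivWithinAt F (f t) (Ici 0) t := by
  intro t ht
  have hg : Continuous fun s => f (max 0 s) :=
    hf.comp_continuous (by fun_prop) fun s => mem_Ici.2 (le_max_left _ _)
  have h := ((hg.integral_hasStrictDerivAt 0 t).hasDerivAt.const_add a).hasDerivWithinAt
    (s := Ici 0)
  rw [max_eq_right ht] at h
  refine h.congr_of_mem (fun s hs => ?_) ht
  rw [hF s hs]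
  congr 1
  refine intervalIntegral.integral_congr fun r hr => ?_
  rw [uIcc_of_le hs] at hr
  simp only [max_eq_right hr.1]

/-- A dominated solution of the integral form of the equation is a solution. -/
theorem isKirchhoffSol_of_integral {lam : ℕ → ℝ} {m : ℝ → ℝ} (hmc : ContinuousOn m (Ici 0))
    {σ δ : ℝ} {u0 u1 : ℕ → ℝ} {u v : ℕ → ℝ → ℝ} (hv : ∀ k, ContinuousOn (v k) (Ici 0))
    (hu : ∀ k, ∀ t ∈ Ici (0:ℝ), u k t = u0 k + ∫ s in (0:ℝ)..t, v k s)
    (hv' : ∀ k, ∀ t ∈ Ici (0:ℝ), v k t = u1 k + ∫ s in (0:ℝ)..t,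
      (-2 * (δ * lam k ^ (2 * σ)) * v k s
        - m (∑' j, lam j ^ 2 * u j s ^ 2) * lam k ^ 2 * u k s))
    (hd : ∀ T : ℝ, ∃ g : ℕ → ℝ, Summable g ∧ ∀ k, ∀ t ∈ Icc 0 T,
      (1 + lam k ^ 2) * u k t ^ 2 + v k t ^ 2 ≤ g k) :
    IsKirchhoffSol lam m σ δ (Ici 0) u0 u1 u := by
  have hdu : ∀ k, ∀ t ∈ Ici (0:ℝ), HasDerivWithinAt (u k) (v k t) (Ici 0) t := fun k =>
    hasDerivWithinAt_add_integral (hv k) _ (hu k)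
  have huc : ∀ k, ContinuousOn (u k) (Ici 0) := fun k t ht => (hdu k t ht).continuousWithinAt
  have hX : ContinuousOn (fun t => ∑' j, lam j ^ 2 * u j t ^ 2) (Ici 0) := by
    refine continuousOn_Ici_of_Icc fun T => ?_
    obtain ⟨g, hg, hug⟩ := hd T
    refine continuousOn_tsum (u := g)
      (fun k => (((huc k).mono Icc_subset_Ici_self).pow 2).const_mul _) hg (fun k t ht => ?_)
    rw [Real.norm_of_nonneg (by positivity)]
    have := hug k t ht
    nlinarith [sq_nonneg (u k t), sq_nonneg (v k t)]
  have hmX : ContinuousOn (fun t => m (∑' j, lam j ^ 2 * u j t ^ 2)) (Ici 0) :=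
    hmc.comp hX fun t _ => mem_Ici.2 (tsum_nonneg fun j => by positivity)
  have hac : ∀ k, ContinuousOn (fun s => -2 * (δ * lam k ^ (2 * σ)) * v k s
        - m (∑' j, lam j ^ 2 * u j s ^ 2) * lam k ^ 2 * u k s) (Ici 0) := fun k =>
    ((hv k).const_mul _).sub ((hmX.mul continuousOn_const).mul (huc k))
  have hdv : ∀ k, ∀ t ∈ Ici (0:ℝ), HasDerivWithinAt (v k) _ (Ici 0) t := fun k =>
    hasDerivWithinAt_add_integral (hac k) _ (hv' k)
  have hud : UniqueDiffOn ℝ (Ici (0:ℝ)) := uniqueDiffOn_Ici 0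
  have heu : ∀ k, ∀ t ∈ Ici (0:ℝ), derivWithin (u k) (Ici 0) t = v k t := fun k t ht =>
    (hdu k t ht).derivWithin (hud t ht)
  have hev : ∀ k, ∀ t ∈ Ici (0:ℝ), derivWithin (v k) (Ici 0) t = _ := fun k t ht =>
    (hdv k t ht).derivWithin (hud t ht)
  have h00 : (0:ℝ) ∈ Ici (0:ℝ) := self_mem_Ici
  refine ⟨fun k => ?_, fun k => ?_, fun k => ?_, fun k t ht => ?_, ?_, ?_, ?_⟩
  · have h1 : ContDiffOn ℝ 1 (v k) (Ici 0) := by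
      rw [← zero_add (1 : WithTop ℕ∞), contDiffOn_succ_iff_derivWithin hud]
      refine ⟨fun t ht => (hdv k t ht).differentiableWithinAt, by simp, ?_⟩
      rw [contDiffOn_zero]
      exact (hac k).congr (hev k)
    rw [← one_add_one_eq_two, contDiffOn_succ_iff_derivWithin hud]
    exact ⟨fun t ht => (hdu k t ht).differentiableWithinAt, by simp, h1.congr (heu k)⟩
  · simpa using hu k 0 h00
  · rw [heu k 0 h00]
    simpa using hv' k 0 h00
  · rw [derivWithin_congr (heu k) (heu k t ht), hev k t ht, heu k t ht]
    ring
  · refine l2Cont_of_dominated huc fun T => ?_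
    obtain ⟨g, hg, hug⟩ := hd T
    refine ⟨g, hg, fun k t ht => le_trans ?_ (hug k t ht)⟩
    nlinarith [sq_nonneg (v k t), sq_nonneg (lam k * u k t)]
  · refine l2Cont_of_dominated (fun k => (huc k).const_mul _) fun T => ?_
    obtain ⟨g, hg, hug⟩ := hd T
    refine ⟨g, hg, fun k t ht => le_trans ?_ (hug k t ht)⟩
    nlinarith [sq_nonneg (v k t), sq_nonneg (u k t)]
  · refine l2Cont_of_dominated (fun k => (hv k).congr (heu k)) fun T => ?_
    obtain ⟨g, hg, hug⟩ := hd T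
    refine ⟨g, hg, fun k t ht => le_trans ?_ (hug k t ht)⟩
    rw [heu k t ht.1]
    nlinarith [sq_nonneg (u k t), sq_nonneg (lam k * u k t)]

/-- Dominated convergence for increments, in terms of derivatives. -/
theorem tendsto_increment_of_tendsto_deriv {f f' : ℕ → ℝ → ℝ} {h : ℝ → ℝ} {t L : ℝ} (ht : 0 ≤ t)
    (hd : ∀ᶠ n in atTop, (∀ s ∈ Icc 0 t, HasDerivWithinAt (f n) (f' n s) (Icc 0 t) s) ∧
      ContinuousOn (f' n) (Icc 0 t) ∧ ∀ s ∈ Icc 0 t, |f' n s| ≤ L)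
    (hlim : ∀ s ∈ Icc 0 t, Tendsto (fun n => f' n s) atTop (𝓝 (h s))) :
    Tendsto (fun n => f n t - f n 0) atTop (𝓝 (∫ s in (0:ℝ)..t, h s)) := by
  have hsub : uIoc 0 t ⊆ Icc 0 t := by
    rw [uIoc_of_le ht]
    exact Ioc_subset_Icc_self
  have hI : Tendsto (fun n => ∫ s in (0:ℝ)..t, f' n s) atTop (𝓝 (∫ s in (0:ℝ)..t, h s)) := by
    refine intervalIntegral.tendsto_integral_filter_of_dominated_convergence (fun _ => L)
      ?_ ?_ intervalIntegrable_const ?_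
    · filter_upwards [hd] with n hn
      exact (hn.2.1.mono hsub).aestronglyMeasurable measurableSet_uIoc
    · filter_upwards [hd] with n hn
      exact Eventually.of_forall fun s hs => hn.2.2 s (hsub hs)
    · exact Eventually.of_forall fun s hs => hlim s (hsub hs)
  refine hI.congr' ?_
  filter_upwards [hd] with n hn
  refine intervalIntegral.integral_eq_sub_of_hasDeriv_right_of_le ht
    (fun s hs => (hn.1 s hs).continuousWithinAt) (fun s hs => ?_) ?_
  · exact ((hn.1 s (Ioo_subset_Icc_self hs)).mono_of_mem_nhdsWithin
      (Icc_mem_nhdsGT_of_mem (Ioo_subset_Ico_self hs)))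
  · refine ContinuousOn.intervalIntegrable ?_
    rw [uIcc_of_le ht]
    exact hn.2.1

/-- Bounded smooth nonnegative functions approximating `m` on larger and larger intervals. -/
theorem exists_smooth_approx_seq {m : ℝ → ℝ} (hmc : ContinuousOn m (Ici 0))
    (hm0 : ∀ x : ℝ, 0 ≤ x → 0 ≤ m x) (n : ℕ) :
    ∃ (g : ℝ → ℝ) (M : ℝ), ContDiff ℝ 1 g ∧ (∀ x, |g x| ≤ M) ∧ (∀ x, 0 ≤ g x) ∧
      ∀ x ∈ Icc (0:ℝ) n, |g x - m x| ≤ 1 / ((n : ℝ) + 1) := by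
  have hn : (0:ℝ) ≤ n := n.cast_nonneg
  have hmem : ∀ x : ℝ, max 0 (min x n) ∈ Icc (0:ℝ) n := fun x =>
    ⟨le_max_left _ _, max_le hn (min_le_right _ _)⟩
  have hc : Continuous fun x => m (max 0 (min x n)) :=
    hmc.comp_continuous (by fun_prop) fun x => mem_Ici.2 (hmem x).1
  obtain ⟨g, hg, hgm⟩ := exists_smooth_nonneg_near _ hc (fun x => hm0 _ (hmem x).1)
    (ε := 1 / ((n : ℝ) + 1)) (by positivity)
  obtain ⟨M, hM⟩ := isCompact_Icc.exists_bound_of_continuousOn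
    (hmc.mono (Icc_subset_Ici_self : Icc (0:ℝ) n ⊆ Ici 0))
  refine ⟨g, M + 1 / ((n : ℝ) + 1), hg, fun x => ?_, fun x => (hgm x).1, fun x hx => ?_⟩
  · have h1 := abs_le.1 (hM _ (hmem x))
    have h2 := abs_le.1 (hgm x).2
    rw [abs_of_nonneg (hgm x).1]
    linarith
  · have := (hgm x).2
    rwa [min_eq_left hx.2, max_eq_right hx.1] at this

/-- Galerkin approximations of the Kirchhoff equation, with bounds in the energy space that are
uniform on bounded time intervals. -/
theorem exists_galerkin_seq {lam : ℕ → ℝ} (hlam : ∀ k, 0 ≤ lam k)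
    {m : ℝ → ℝ} (hmc : ContinuousOn m (Ici 0)) (hm0 : ∀ x : ℝ, 0 ≤ x → 0 ≤ m x)
    {σ δ : ℝ} (hσ : 1 / 2 < σ) (hδ : 0 < δ) {u0 u1 : ℕ → ℝ}
    (hu0 : Summable fun k => (1 + lam k ^ 2) * u0 k ^ 2) (hu1 : Summable fun k => u1 k ^ 2) :
    ∃ (c : ℕ → ℝ → ℝ) (U V : ℕ → ℕ → ℝ → ℝ), ∀ T : ℝ, ∃ B K : ℝ, 0 ≤ B ∧ 0 ≤ K ∧ ∀ᶠ n in atTop,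
      ContinuousOn (c n) (Icc 0 T) ∧
      (∀ t ∈ Icc 0 T, 0 ≤ c n t ∧ c n t ≤ B ∧
        |c n t - m (∑' j, lam j ^ 2 * U n j t ^ 2)| ≤ 1 / ((n : ℝ) + 1)) ∧
      (∀ k, ∀ t ∈ Icc 0 T, (1 + lam k ^ 2) * U n k t ^ 2 + V n k t ^ 2 ≤
        K * ((1 + lam k ^ 2) * u0 k ^ 2 + u1 k ^ 2)) ∧
      ∀ k < n, U n k 0 = u0 k ∧ V n k 0 = u1 k ∧ ∀ t ∈ Icc 0 T,
        HasDerivWithinAt (U n k) (V n k t) (Icc 0 T) t ∧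
        HasDerivWithinAt (V n k) (-2 * (δ * lam k ^ (2 * σ)) * V n k t
          - c n t * lam k ^ 2 * U n k t) (Icc 0 T) t := by
  choose g M hg hM hg0 hgm using exists_smooth_approx_seq hmc hm0
  choose U V hUV hzero using fun n : ℕ =>
    exists_galerkin lam (fun k => δ * lam k ^ (2 * σ)) (hg n) (hM n) u0 u1 n n.cast_nonneg
  have htsum : ∀ n t, ∑' j, lam j ^ 2 * U n j t ^ 2 =
      ∑ j ∈ Finset.range n, lam j ^ 2 * U n j t ^ 2 := fun n t =>
    tsum_eq_sum fun j hj => by simp [(hzero n j hj t).1]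
  refine ⟨fun n t => g n (∑ j ∈ Finset.range n, lam j ^ 2 * U n j t ^ 2), U, V, fun T => ?_⟩
  have hs0 : Summable fun k => lam k ^ 2 * u0 k ^ 2 :=
    Summable.of_nonneg_of_le (fun k => by positivity)
      (fun k => by nlinarith [sq_nonneg (u0 k)]) hu0
  have hs1 : Summable fun k => 2 * ((1 + lam k ^ 2) * u0 k ^ 2) + 2 / δ ^ 2 * u1 k ^ 2 :=
    (hu0.mul_left 2).add (hu1.mul_left _)
  set S₀ : ℝ := ∑' k, lam k ^ 2 * u0 k ^ 2
  set S₁ : ℝ := ∑' k, (2 * ((1 + lam k ^ 2) * u0 k ^ 2) + 2 / δ ^ 2 * u1 k ^ 2)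
  have hmb : ∀ R : ℝ, ∃ B, 0 ≤ B ∧ ∀ x ∈ Icc 0 R, m x ≤ B := by
    intro R
    obtain ⟨B, hB⟩ := isCompact_Icc.exists_bound_of_continuousOn
      (hmc.mono (Icc_subset_Ici_self : Icc (0:ℝ) R ⊆ Ici 0))
    exact ⟨max 0 B, le_max_left _ _, fun x hx =>
      (le_abs_self _).trans ((hB x hx).trans (le_max_right _ _))⟩
  obtain ⟨B₀, hB₀, hmB₀⟩ := hmb S₀
  set C : ℝ := 2 * (S₁ + S₀ * (B₀ + 1) / δ ^ 2) * Real.exp ((1 + 2 * δ ^ 2) * T)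
  obtain ⟨B₁, hB₁, hmB₁⟩ := hmb C
  obtain ⟨K, hK, hKe⟩ := exists_mode_energy_bound hσ hδ (B₁ + 1) T
  refine ⟨B₁ + 1, K, by linarith, hK, ?_⟩
  filter_upwards [eventually_ge_atTop ⌈max T (max S₀ C)⌉₊] with n hn
  obtain ⟨hTn, hSn, hCn⟩ : T ≤ n ∧ S₀ ≤ n ∧ C ≤ n := by simpa using Nat.ceil_le.1 hn
  have hn1 : 1 / ((n : ℝ) + 1) ≤ 1 := by
    rw [div_le_one (by positivity)]
    linarith [n.cast_nonneg (α := ℝ)]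
  have hsub : Icc 0 T ⊆ Icc 0 (n : ℝ) := Icc_subset_Icc_right hTn
  have hode : ∀ k ∈ Finset.range n, U n k 0 = u0 k ∧ V n k 0 = u1 k ∧ ∀ t ∈ Icc 0 T,
      HasDerivWithinAt (U n k) (V n k t) (Icc 0 T) t ∧
      HasDerivWithinAt (V n k) (-2 * (δ * lam k ^ (2 * σ)) * V n k t
        - g n (∑ j ∈ Finset.range n, lam j ^ 2 * U n j t ^ 2) * lam k ^ 2 * U n k t)
        (Icc 0 T) t := fun k hk =>
    ⟨(hUV n k hk).1, (hUV n k hk).2.1, fun t ht =>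
      ⟨((hUV n k hk).2.2 t (hsub ht)).1.mono hsub, ((hUV n k hk).2.2 t (hsub ht)).2.mono hsub⟩⟩
  have hX0 : ∀ t, 0 ≤ ∑ j ∈ Finset.range n, lam j ^ 2 * U n j t ^ 2 := fun t =>
    Finset.sum_nonneg fun j _ => by positivity
  have hXC : ∀ t ∈ Icc 0 T, ∑ j ∈ Finset.range n, lam j ^ 2 * U n j t ^ 2 ≤ C := by
    intro t ht
    refine (galerkin_energy_bound hδ hlam (fun k => by have := hlam k; positivity)
      (fun k hk => ?_) (hg n).continuous (hg0 n) hode t ht).trans ?_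
    · exact mul_le_mul_of_nonneg_left (Real.self_le_rpow_of_one_le hk.le (by linarith)) hδ.le
    · have hS₁ := hs1.sum_le_tsum (Finset.range n) fun k _ => by positivity
      have hS₀ := hs0.sum_le_tsum (Finset.range n) fun k _ => by positivity
      have hnn : 0 ≤ ∑ j ∈ Finset.range n, lam j ^ 2 * u0 j ^ 2 :=
        Finset.sum_nonneg fun j _ => by positivity
      have hint : ∫ x in (0:ℝ)..(∑ j ∈ Finset.range n, lam j ^ 2 * u0 j ^ 2), g n x ≤
          S₀ * (B₀ + 1) := by
        have h1 : ∫ x in (0:ℝ)..(∑ j ∈ Finset.range n, lam j ^ 2 * u0 j ^ 2), g n x ≤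
            ∫ _ in (0:ℝ)..(∑ j ∈ Finset.range n, lam j ^ 2 * u0 j ^ 2), (B₀ + 1) := by
          refine intervalIntegral.integral_mono_on hnn
            ((hg n).continuous.intervalIntegrable _ _) intervalIntegrable_const fun x hx => ?_
          have h2 := (abs_le.1 (hgm n x ⟨hx.1, (hx.2.trans hS₀).trans hSn⟩)).2
          have h3 := hmB₀ x ⟨hx.1, hx.2.trans hS₀⟩
          linarith
        rw [intervalIntegral.integral_const, smul_eq_mul, sub_zero] at h1
        exact h1.trans (mul_le_mul_of_nonneg_right hS₀ (by linarith))
      change _ ≤ 2 * (S₁ + S₀ * (B₀ + 1) / δ ^ 2) * Real.exp ((1 + 2 * δ ^ 2) * T)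
      gcongr
  have hcb : ∀ t ∈ Icc 0 T, 0 ≤ g n (∑ j ∈ Finset.range n, lam j ^ 2 * U n j t ^ 2) ∧
      g n (∑ j ∈ Finset.range n, lam j ^ 2 * U n j t ^ 2) ≤ B₁ + 1 := by
    intro t ht
    have h1 := (abs_le.1 (hgm n _ ⟨hX0 t, (hXC t ht).trans hCn⟩)).2
    have h2 := hmB₁ _ ⟨hX0 t, hXC t ht⟩
    exact ⟨hg0 n _, by linarith⟩
  refine ⟨?_, fun t ht => ⟨(hcb t ht).1, (hcb t ht).2, ?_⟩, fun k t ht => ?_,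
    fun k hk => hode k (Finset.mem_range.2 hk)⟩
  · refine (hg n).continuous.comp_continuousOn (continuousOn_finsetSum _ fun j hj => ?_)
    have hUj : ContinuousOn (U n j) (Icc 0 T) := fun t ht =>
      ((hode j hj).2.2 t ht).1.continuousWithinAt
    exact (hUj.pow 2).const_mul _
  · rw [htsum]
    exact hgm n _ ⟨hX0 t, (hXC t ht).trans hCn⟩
  · by_cases hk : k ∈ Finset.range n
    · have := hKe (lam k) (hlam k) (U n k) (V n k) _ (fun t ht => ((hode k hk).2.2 t ht).1)
        (fun t ht => ((hode k hk).2.2 t ht).2) hcb t ht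
      rwa [(hode k hk).1, (hode k hk).2.1] at this
    · rw [(hzero n k hk t).1, (hzero n k hk t).2]
      simp only [ne_eq, OfNat.ofNat_ne_zero, not_false_eq_true, zero_pow, mul_zero, add_zero]
      positivity

/-- Supercritical dissipation: global existence in the energy space for the Kirchhoff
equation with strong damping `A^σ u'`, `σ > 1/2`, assuming only continuity and
nonnegativity (degenerate hyperbolicity) of `m`. -/
theorem global_existence_supercritical
    (lam : ℕ → ℝ) (hlam : ∀ k, 0 ≤ lam k)
    (m : ℝ → ℝ) (hmc : ContinuousOn m (Ici 0)) (hm0 : ∀ x : ℝ, 0 ≤ x → 0 ≤ m x)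
    (σ δ : ℝ) (hσ : 1 / 2 < σ) (hδ : 0 < δ)
    (u0 u1 : ℕ → ℝ)
    (hu0 : Summable fun k => (1 + lam k ^ 2) * u0 k ^ 2)
    (hu1 : Summable fun k => u1 k ^ 2) :
    ∃ u : ℕ → ℝ → ℝ, IsKirchhoffSol lam m σ δ (Ici 0) u0 u1 u := by
  obtain ⟨c, U, V, h⟩ := exists_galerkin_seq hlam hmc hm0 hσ hδ hu0 hu1
  have hbound : ∀ k (T : ℝ), ∃ R L : ℝ, 0 ≤ R ∧ 0 ≤ L ∧ ∀ᶠ n in atTop, ∀ t ∈ Icc 0 T,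
      |V n k t| ≤ R ∧
      |-2 * (δ * lam k ^ (2 * σ)) * V n k t - c n t * lam k ^ 2 * U n k t| ≤ L := by
    intro k T
    obtain ⟨B, K, hB, hK, hT⟩ := h T
    have hl := hlam k
    set R : ℝ := K * ((1 + lam k ^ 2) * u0 k ^ 2 + u1 k ^ 2) + 1
    have hR : 1 ≤ R := le_add_of_nonneg_left (by positivity)
    refine ⟨R, 2 * (δ * lam k ^ (2 * σ)) * R + B * lam k ^ 2 * R, by linarith, by positivity, ?_⟩
    filter_upwards [hT] with n hn t ht
    have he : (1 + lam k ^ 2) * U n k t ^ 2 + V n k t ^ 2 ≤ R - 1 := by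
      simpa [R] using hn.2.2.1 k t ht
    have hV : |V n k t| ≤ R := abs_le_of_sq_le_sq
      (by nlinarith [sq_nonneg (U n k t), sq_nonneg (lam k * U n k t)]) (by linarith)
    have hU : |U n k t| ≤ R := abs_le_of_sq_le_sq
      (by nlinarith [sq_nonneg (V n k t), sq_nonneg (lam k * U n k t)]) (by linarith)
    refine ⟨hV, (abs_sub _ _).trans ?_⟩
    obtain ⟨hc0, hcB, -⟩ := hn.2.1 t ht
    rw [abs_mul, abs_mul (c n t * lam k ^ 2), abs_of_nonneg (by positivity : 0 ≤ c n t * lam k ^ 2),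
      neg_mul, abs_neg, abs_of_nonneg (by positivity : 0 ≤ 2 * (δ * lam k ^ (2 * σ)))]
    gcongr
  obtain ⟨φ, hφ, v, hv, hvc⟩ := exists_subseq_tendsto_of_equiLipschitz (F := V) fun k T => by
    obtain ⟨R, L, hR, hL, hRL⟩ := hbound k T
    obtain ⟨B, K, hB, hK, hT⟩ := h T
    refine ⟨R, L, hR, hL, ?_⟩
    filter_upwards [hRL, hT, eventually_gt_atTop k] with n hn hode hkn t ht
    refine ⟨(hn t ht).1, fun s hs => ?_⟩
    exact (convex_Icc 0 T).norm_image_sub_le_of_norm_hasDerivWithin_le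
      (fun r hr => ((hode.2.2.2 k hkn).2.2 r hr).2) (fun r hr => (hn r hr).2) hs ht
  set u : ℕ → ℝ → ℝ := fun k t => u0 k + ∫ s in (0:ℝ)..t, v k s
  have hstart : ∀ k, ∀ᶠ n in atTop, U (φ n) k 0 = u0 k ∧ V (φ n) k 0 = u1 k := by
    intro k
    obtain ⟨B, K, hB, hK, hT⟩ := h 0
    filter_upwards [hφ.tendsto_atTop.eventually (hT.and (eventually_gt_atTop k))] with n hn
    exact ⟨(hn.1.2.2.2 k hn.2).1, (hn.1.2.2.2 k hn.2).2.1⟩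
  have hu : ∀ k, ∀ t ∈ Ici (0:ℝ), Tendsto (fun n => U (φ n) k t) atTop (𝓝 (u k t)) := by
    intro k t ht
    obtain ⟨R, L, hR, hL, hRL⟩ := hbound k t
    obtain ⟨B, K, hB, hK, hT⟩ := h t
    have hlim := tendsto_increment_of_tendsto_deriv (f := fun n => U (φ n) k)
      (f' := fun n => V (φ n) k) (h := v k) (L := R) ht (by
        filter_upwards [hφ.tendsto_atTop.eventually
          (hRL.and (hT.and (eventually_gt_atTop k)))] with n hn
        have hode := (hn.2.1.2.2.2 k hn.2.2).2.2
        exact ⟨fun s hs => (hode s hs).1, fun s hs => (hode s hs).2.continuousWithinAt,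
          fun s hs => (hn.1 s hs).1⟩) (fun s hs => hv k s hs.1)
    refine (hlim.const_add (u0 k)).congr' ?_
    filter_upwards [hstart k] with n hn
    rw [hn.1]
    ring
  have hd : ∀ T : ℝ, ∃ g : ℕ → ℝ, Summable g ∧ (∀ᶠ n in atTop, ∀ k, ∀ t ∈ Icc 0 T,
      (1 + lam k ^ 2) * U (φ n) k t ^ 2 + V (φ n) k t ^ 2 ≤ g k) ∧ ∀ k, ∀ t ∈ Icc 0 T,
      (1 + lam k ^ 2) * u k t ^ 2 + v k t ^ 2 ≤ g k := by
    intro T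
    obtain ⟨B, K, hB, hK, hT⟩ := h T
    have hUV : ∀ᶠ n in atTop, ∀ k, ∀ t ∈ Icc 0 T, (1 + lam k ^ 2) * U (φ n) k t ^ 2
        + V (φ n) k t ^ 2 ≤ K * ((1 + lam k ^ 2) * u0 k ^ 2 + u1 k ^ 2) := by
      filter_upwards [hφ.tendsto_atTop.eventually hT] with n hn using hn.2.2.1
    refine ⟨_, (hu0.add hu1).mul_left K, hUV, fun k t ht => ?_⟩
    refine le_of_tendsto ((((hu k t ht.1).pow 2).const_mul _).add ((hv k t ht.1).pow 2)) ?_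
    filter_upwards [hUV] with n hn using hn k t ht
  have hc : ∀ t ∈ Ici (0:ℝ), Tendsto (fun n => c (φ n) t) atTop
      (𝓝 (m (∑' j, lam j ^ 2 * u j t ^ 2))) := by
    intro t ht
    have htt : t ∈ Icc 0 t := ⟨ht, le_rfl⟩
    obtain ⟨g, hg, hUg, -⟩ := hd t
    have hX : Tendsto (fun n => ∑' j, lam j ^ 2 * U (φ n) j t ^ 2) atTop
        (𝓝 (∑' j, lam j ^ 2 * u j t ^ 2)) := by
      refine tendsto_tsum_of_dominated_convergence hg
        (fun j => ((hu j t ht).pow 2).const_mul _) ?_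
      filter_upwards [hUg] with n hn j
      rw [Real.norm_of_nonneg (by positivity)]
      nlinarith [hn j t htt, sq_nonneg (U (φ n) j t), sq_nonneg (V (φ n) j t)]
    have hmem : ∀ w : ℕ → ℝ, (∑' j, lam j ^ 2 * w j ^ 2) ∈ Ici (0:ℝ) := fun w =>
      mem_Ici.2 (tsum_nonneg fun j => by positivity)
    have hmX : Tendsto (fun n => m (∑' j, lam j ^ 2 * U (φ n) j t ^ 2)) atTop
        (𝓝 (m (∑' j, lam j ^ 2 * u j t ^ 2))) :=
      (hmc _ (hmem fun j => u j t)).tendsto.comp (tendsto_nhdsWithin_iff.2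
        ⟨hX, Eventually.of_forall fun n => hmem fun j => U (φ n) j t⟩)
    obtain ⟨B, K, hB, hK, hT⟩ := h t
    have hdiff : Tendsto (fun n => c (φ n) t - m (∑' j, lam j ^ 2 * U (φ n) j t ^ 2)) atTop
        (𝓝 0) := by
      refine squeeze_zero_norm' ?_
        ((tendsto_one_div_add_atTop_nhds_zero_nat (𝕜 := ℝ)).comp hφ.tendsto_atTop)
      filter_upwards [hφ.tendsto_atTop.eventually hT] with n hn using (hn.2.1 t htt).2.2
    simpa using hdiff.add hmX
  refine ⟨u, isKirchhoffSol_of_integral hmc hvc (fun k t _ => rfl) (fun k t ht => ?_) fun T => ?_⟩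
  · obtain ⟨R, L, hR, hL, hRL⟩ := hbound k t
    obtain ⟨B, K, hB, hK, hT⟩ := h t
    have hlim := tendsto_increment_of_tendsto_deriv (f := fun n => V (φ n) k)
      (f' := fun n s => -2 * (δ * lam k ^ (2 * σ)) * V (φ n) k s
        - c (φ n) s * lam k ^ 2 * U (φ n) k s)
      (h := fun s => -2 * (δ * lam k ^ (2 * σ)) * v k s
        - m (∑' j, lam j ^ 2 * u j s ^ 2) * lam k ^ 2 * u k s) (L := L) ht (by
        filter_upwards [hφ.tendsto_atTop.eventually
          (hRL.and (hT.and (eventually_gt_atTop k)))] with n hn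
        have hode := (hn.2.1.2.2.2 k hn.2.2).2.2
        have hUc : ContinuousOn (U (φ n) k) (Icc 0 t) := fun s hs =>
          (hode s hs).1.continuousWithinAt
        have hVc : ContinuousOn (V (φ n) k) (Icc 0 t) := fun s hs =>
          (hode s hs).2.continuousWithinAt
        exact ⟨fun s hs => (hode s hs).2,
          (hVc.const_mul _).sub ((hn.2.1.1.mul continuousOn_const).mul hUc),
          fun s hs => (hn.1 s hs).2⟩)
      (fun s hs => ((hv k s hs.1).const_mul _).sub
        (((hc s hs.1).mul_const _).mul (hu k s hs.1)))
    refine tendsto_nhds_unique (hv k t ht) ((hlim.const_add (u1 k)).congr' ?_)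
    filter_upwards [hstart k] with n hn
    rw [hn.2]
    ring
  · obtain ⟨g, hg, -, hug⟩ := hd T
    exact ⟨g, hg, hug⟩
end
end

section
/- Let λ : ℕ → [0,∞) be a sequence, let m : [0,∞) → [0,∞) satisfy m(x) ≥ μ₁ > 0 for every x ≥ 0 and |m(a) − m(b)| ≤ ω_m(|a−b|) for all a,b ≥ 0, where ω_m is a continuity modulus. Let σ ∈ (0,1/2] and δ > 0 be real numbers, and let α ∈ [0,1/4) satisfy limsup_{x→0⁺} (ω_m(x))^{4α} / x^{1−2σ} < +∞. If (u⁰,u¹) ∈ D(A^{α+1/2}) × D(A^α), then there exists T > 0 and a solution on [0,T] of the Kirchhoff equation u'' + 2δ A^σ u' + m(|A^{1/2}u|²) A u = 0 with initial data (u⁰,u¹), belonging to C⁰([0,T], D(A^{α+1/2})) ∩ C¹([0,T], D(A^α)) (i.e. additionally the curves t ↦ (λ_k^{2α+1} u_k(t))_k and t ↦ (λ_k^{2α} u_k'(t))_k are continuous with values in ℓ²). -/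
open Set Filter MeasureTheory Topology

noncomputable section

/-- The first-order vector field of the scalar oscillator `y'' + a y' + b c(t) y = 0`,
acting on pairs `(y, y')`. -/
def oscField (a b : ℝ) (c : ℝ → ℝ) (t : ℝ) (x : ℝ × ℝ) : ℝ × ℝ :=
  (x.2, -(a * x.2) - b * c t * x.1)

/-- `X = (y, y')` solves `y'' + a y' + b c(t) y = 0` on `[0, T]` with initial datum `x₀`. -/
structure IsOscSol (a b : ℝ) (c : ℝ → ℝ) (T : ℝ) (x₀ : ℝ × ℝ) (X : ℝ → ℝ × ℝ) : Prop where
  init : X 0 = x₀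
  deriv : ∀ t ∈ Icc 0 T, HasDerivWithinAt X (oscField a b c t (X t)) (Icc 0 T) t

section Oscillator

variable {a b M T : ℝ} {c : ℝ → ℝ} {x₀ : ℝ × ℝ}

lemma norm_oscField_le (ha : 0 ≤ a) (hb : 0 ≤ b) {t : ℝ} (hc : |c t| ≤ M) (x : ℝ × ℝ) :
    ‖oscField a b c t x‖ ≤ (1 + a + b * M) * ‖x‖ := by
  have h1 : |x.1| ≤ ‖x‖ := norm_fst_le x
  have h2 : |x.2| ≤ ‖x‖ := norm_snd_le x
  have h0 : 0 ≤ ‖x‖ := norm_nonneg x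
  have hM : 0 ≤ M := (abs_nonneg _).trans hc
  have h3 : |b * c t * x.1| ≤ b * M * ‖x‖ := by
    rw [abs_mul, abs_mul, abs_of_nonneg hb]
    gcongr
  have h4 : |a * x.2| ≤ a * ‖x‖ := by
    rw [abs_mul, abs_of_nonneg ha]
    gcongr
  refine norm_prod_le_iff.2 ⟨?_, ?_⟩
  · change |x.2| ≤ _
    nlinarith [mul_nonneg ha h0, mul_nonneg (mul_nonneg hb hM) h0]
  · change |-(a * x.2) - b * c t * x.1| ≤ _
    have := abs_sub (-(a * x.2)) (b * c t * x.1)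
    rw [abs_neg] at this
    nlinarith

lemma oscField_sub (a b : ℝ) (c : ℝ → ℝ) (t : ℝ) (x y : ℝ × ℝ) :
    oscField a b c t x - oscField a b c t y = oscField a b c t (x - y) := by
  ext <;> simp [oscField]
  ring

/-- Coordinatewise truncation of a pair to the square `[-R, R]²`. -/
def clampPair (R : ℝ) (x : ℝ × ℝ) : ℝ × ℝ := (max (-R) (min R x.1), max (-R) (min R x.2))

lemma abs_clamp_sub_le (R x y : ℝ) : |max (-R) (min R x) - max (-R) (min R y)| ≤ |x - y| := by
  refine (abs_max_sub_max_le_max _ _ _ _).trans ?_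
  rw [sub_self, abs_zero]
  refine max_le (abs_nonneg _) ((abs_min_sub_min_le_max _ _ _ _).trans ?_)
  simp

lemma norm_clampPair_sub_le (R : ℝ) (x y : ℝ × ℝ) :
    ‖clampPair R x - clampPair R y‖ ≤ ‖x - y‖ :=
  norm_prod_le_iff.2
    ⟨(abs_clamp_sub_le R x.1 y.1).trans (norm_fst_le (x - y)),
      (abs_clamp_sub_le R x.2 y.2).trans (norm_snd_le (x - y))⟩

lemma clampPair_of_norm_le {R : ℝ} {x : ℝ × ℝ} (h : ‖x‖ ≤ R) : clampPair R x = x := by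
  have h1 := abs_le.1 ((norm_fst_le x).trans h)
  have h2 := abs_le.1 ((norm_snd_le x).trans h)
  ext <;> simp [clampPair, h1, h2]

lemma norm_clampPair_le_norm {R : ℝ} (hR : 0 ≤ R) (x : ℝ × ℝ) : ‖clampPair R x‖ ≤ ‖x‖ := by
  have h := norm_clampPair_sub_le R x 0
  rwa [clampPair_of_norm_le (x := 0) (by simpa using hR), sub_zero, sub_zero] at h

lemma norm_clampPair_le {R : ℝ} (hR : 0 ≤ R) (x : ℝ × ℝ) : ‖clampPair R x‖ ≤ R :=
  norm_prod_le_iff.2 ⟨abs_le.2 ⟨le_max_left _ _, max_le (by linarith) (min_le_left _ _)⟩,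
    abs_le.2 ⟨le_max_left _ _, max_le (by linarith) (min_le_left _ _)⟩⟩

lemma HasDerivWithinAt.Ici_of_Icc {E : Type*} [NormedAddCommGroup E] [NormedSpace ℝ E]
    {f : ℝ → E} {f' : E} {S T t : ℝ} (hS : S ≤ T)
    (h : HasDerivWithinAt f f' (Icc 0 T) t) (ht : t ∈ Ico 0 S) :
    HasDerivWithinAt f f' (Ici t) t :=
  h.mono_of_mem_nhdsWithin (Icc_mem_nhdsGE_of_mem ⟨ht.1, ht.2.trans_le hS⟩)

lemma exists_isOscSol (ha : 0 ≤ a) (hb : 0 ≤ b) (hc : Continuous c) (hM : ∀ t, |c t| ≤ M)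
    (hT : 0 ≤ T) (x₀ : ℝ × ℝ) : ∃ X, IsOscSol a b c T x₀ X := by
  have hM0 : 0 ≤ M := (abs_nonneg _).trans (hM 0)
  set K : ℝ := 1 + a + b * M with hK
  have hK0 : 0 ≤ K := by positivity
  set R : ℝ := ‖x₀‖ * Real.exp (K * T) with hR
  have hR0 : 0 ≤ R := by positivity
  have hpl : IsPicardLindelof (fun t x => oscField a b c t (clampPair R x))
      (⟨0, left_mem_Icc.2 hT⟩ : Icc 0 T) x₀ (Real.toNNReal (K * R * T)) 0
      (Real.toNNReal (K * R)) (Real.toNNReal K) := by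
    refine ⟨fun t _ => ?_, fun x _ => ?_, fun t _ x _ => ?_, ?_⟩
    · refine LipschitzOnWith.of_dist_le_mul fun x _ y _ => ?_
      rw [dist_eq_norm, dist_eq_norm, oscField_sub, Real.coe_toNNReal _ hK0]
      refine (norm_oscField_le ha hb (hM t) _).trans ?_
      gcongr
      exact norm_clampPair_sub_le R x y
    · unfold oscField
      fun_prop
    · rw [Real.coe_toNNReal _ (by positivity)]
      refine (norm_oscField_le ha hb (hM t) _).trans ?_
      gcongr
      exact norm_clampPair_le hR0 x
    · rw [Real.coe_toNNReal _ (by positivity), Real.coe_toNNReal _ (by positivity)]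
      simp [hT]
  obtain ⟨X, hX0, hX⟩ := hpl.exists_eq_forall_mem_Icc_hasDerivWithinAt₀
  have hbound : ∀ t ∈ Icc 0 T, ‖X t‖ ≤ R := by
    intro t ht
    have := norm_le_gronwallBound_of_norm_deriv_right_le (δ := ‖x₀‖) (K := K) (ε := 0)
      (fun t ht => (hX t ht).continuousWithinAt)
      (fun t ht => (hX t (Ico_subset_Icc_self ht)).Ici_of_Icc le_rfl ht) (by rw [← hX0])
      (fun t _ => by
        rw [add_zero]
        refine (norm_oscField_le ha hb (hM t) _).trans ?_
        gcongr
        exact norm_clampPair_le_norm hR0 _) t ht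
    rw [gronwallBound_ε0, sub_zero] at this
    refine this.trans ?_
    rw [hR]
    gcongr
    exact ht.2
  refine ⟨X, hX0, fun t ht => ?_⟩
  have := hX t ht
  rwa [clampPair_of_norm_le (hbound t ht)] at this

namespace IsOscSol

variable {X X' : ℝ → ℝ × ℝ} {c' : ℝ → ℝ}

lemma continuousOn (h : IsOscSol a b c T x₀ X) : ContinuousOn X (Icc 0 T) :=
  fun t ht => (h.deriv t ht).continuousWithinAt

lemma hasDerivWithinAt_fst (h : IsOscSol a b c T x₀ X) {t : ℝ} (ht : t ∈ Icc 0 T) :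
    HasDerivWithinAt (fun t => (X t).1) (X t).2 (Icc 0 T) t :=
  (hasDerivWithinAt_iff_hasFDerivWithinAt.1 (h.deriv t ht)).fst.hasDerivWithinAt.congr_deriv
    (by simp [oscField])

lemma hasDerivWithinAt_snd (h : IsOscSol a b c T x₀ X) {t : ℝ} (ht : t ∈ Icc 0 T) :
    HasDerivWithinAt (fun t => (X t).2) (-(a * (X t).2) - b * c t * (X t).1) (Icc 0 T) t :=
  (hasDerivWithinAt_iff_hasFDerivWithinAt.1 (h.deriv t ht)).snd.hasDerivWithinAt.congr_deriv
    (by simp [oscField])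

lemma norm_le (h : IsOscSol a b c T x₀ X) (ha : 0 ≤ a) (hb : 0 ≤ b) (hM : ∀ t, |c t| ≤ M)
    {t : ℝ} (ht : t ∈ Icc 0 T) : ‖X t‖ ≤ ‖x₀‖ * Real.exp ((1 + a + b * M) * T) := by
  have hM0 : 0 ≤ M := (abs_nonneg _).trans (hM 0)
  have := norm_le_gronwallBound_of_norm_deriv_right_le (δ := ‖x₀‖) (K := 1 + a + b * M) (ε := 0)
    h.continuousOn
    (fun t ht => (h.deriv t (Ico_subset_Icc_self ht)).Ici_of_Icc le_rfl ht) (by rw [← h.init])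
    (fun t _ => by
      rw [add_zero]
      exact norm_oscField_le ha hb (hM t) _) t ht
  rw [gronwallBound_ε0, sub_zero] at this
  refine this.trans ?_
  gcongr
  exact ht.2

lemma norm_sub_le (h : IsOscSol a b c T x₀ X) (h' : IsOscSol a b c' T x₀ X')
    (ha : 0 ≤ a) (hb : 0 ≤ b) (hM : ∀ t, |c t| ≤ M) {R S ε : ℝ} (hS : S ≤ T)
    (hR : ∀ t ∈ Icc 0 T, ‖X' t‖ ≤ R) (hε : ∀ t ∈ Ico 0 S, |c t - c' t| ≤ ε)
    {t : ℝ} (ht : t ∈ Icc 0 S) :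
    ‖X t - X' t‖ ≤ gronwallBound 0 (1 + a + b * M) (b * (ε * R)) t := by
  have hsub : Icc 0 S ⊆ Icc 0 T := Icc_subset_Icc_right hS
  have := norm_le_gronwallBound_of_norm_deriv_right_le (f := fun t => X t - X' t)
    (δ := 0) (K := 1 + a + b * M) (ε := b * (ε * R))
    ((h.continuousOn.sub h'.continuousOn).mono hsub)
    (fun t ht => ((h.deriv t (hsub (Ico_subset_Icc_self ht))).sub
      (h'.deriv t (hsub (Ico_subset_Icc_self ht)))).Ici_of_Icc hS ht)
    (by rw [h.init, h'.init, sub_self, norm_zero])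
    (fun t ht => ?_) t ht
  · rwa [sub_zero] at this
  · have hmem := Ico_subset_Icc_self ht
    have hsplit : oscField a b c t (X t) - oscField a b c' t (X' t)
        = oscField a b c t (X t - X' t) + (0, -(b * ((c t - c' t) * (X' t).1))) := by
      ext <;> simp [oscField]
      ring
    rw [hsplit]
    refine (norm_add_le _ _).trans (add_le_add (norm_oscField_le ha hb (hM t) _) ?_)
    refine norm_prod_le_iff.2 ⟨?_, ?_⟩
    · have h1 := (abs_nonneg _).trans (hε t ht)
      have h2 := (norm_nonneg _).trans (hR t (hsub hmem))
      simp only [norm_zero]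
      positivity
    · change |-(b * ((c t - c' t) * (X' t).1))| ≤ _
      rw [abs_neg, abs_mul, abs_mul, abs_of_nonneg hb]
      have h1 := hε t ht
      have h2 : |(X' t).1| ≤ R := (norm_fst_le _).trans (hR t (hsub hmem))
      have h3 := (abs_nonneg _).trans h1
      gcongr

end IsOscSol

end Oscillator

section Energy

variable {μ M T : ℝ} {c : ℝ → ℝ}

lemma IsOscSol.energy_le {d l p : ℝ} {x₀ : ℝ × ℝ} {X : ℝ → ℝ × ℝ} {C C' : ℝ → ℝ}
    (h : IsOscSol (2 * d) (l ^ 2) c T x₀ X) (hμ : 0 < μ) (hl : 0 ≤ l)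
    (hpd : p ≤ d) (hpμ : p ≤ d * μ) (hc : ∀ t, μ ≤ c t)
    (hC : ∀ t ∈ Icc 0 T, HasDerivWithinAt C (C' t) (Icc 0 T) t)
    (hCμ : ∀ t, μ ≤ C t) (hCM : ∀ t, C t ≤ M)
    (hCc : ∀ t, |C t - c t| * l ≤ p) (hC' : ∀ t, |C' t| ≤ p) {t : ℝ} (ht : t ∈ Icc 0 T) :
    (X t).2 ^ 2 + l ^ 2 * (X t).1 ^ 2 ≤
      (2 + 1 / μ) * (2 * x₀.2 ^ 2 + (3 * d ^ 2 + M * l ^ 2) * x₀.1 ^ 2) := by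
  have hp : 0 ≤ p := (abs_nonneg _).trans (hC' 0)
  set E : ℝ → ℝ := fun t => (X t).2 ^ 2 + 2 * d * ((X t).1 * (X t).2)
    + (C t * l ^ 2 + 2 * d ^ 2) * (X t).1 ^ 2 with hE
  have hder : ∀ t ∈ Icc 0 T, HasDerivWithinAt E
      (-(2 * d * (X t).2 ^ 2) + 2 * ((C t - c t) * l ^ 2 * ((X t).1 * (X t).2))
        - (2 * d * c t - C' t) * (l ^ 2 * (X t).1 ^ 2)) (Icc 0 T) t := by
    intro t ht
    have h1 := h.hasDerivWithinAt_fst ht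
    have h2 := h.hasDerivWithinAt_snd ht
    have := ((h2.pow 2).add ((h1.mul h2).const_mul (2 * d))).add
      ((((hC t ht).mul_const (l ^ 2)).add_const (2 * d ^ 2)).mul (h1.pow 2))
    refine this.congr_deriv ?_
    simp only [Pi.pow_apply]
    push_cast
    ring
  have hanti : AntitoneOn E (Icc 0 T) := by
    refine antitoneOn_of_hasDerivWithinAt_nonpos (convex_Icc 0 T)
      (fun t ht => (hder t ht).continuousWithinAt)
      (fun t ht => (hder t (interior_subset ht)).mono interior_subset) (fun t ht => ?_)
    set y := (X t).1
    set z := (X t).2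
    have h1 : (C t - c t) * l ^ 2 * (y * z) ≤ p * (|l * y| * |z|) := by
      refine (le_abs_self _).trans ?_
      have : |(C t - c t) * l ^ 2 * (y * z)| = (|C t - c t| * l) * (|l * y| * |z|) := by
        simp only [abs_mul, abs_pow, abs_of_nonneg hl]
        ring
      rw [this]
      gcongr
      exact hCc t
    have h2 : 2 * (|l * y| * |z|) ≤ l ^ 2 * y ^ 2 + z ^ 2 := by
      have := sq_nonneg (|l * y| - |z|)
      have e1 := sq_abs (l * y)
      have e2 := sq_abs z
      nlinarith
    have h3 : C' t * (l ^ 2 * y ^ 2) ≤ p * (l ^ 2 * y ^ 2) := by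
      gcongr
      exact (le_abs_self _).trans (hC' t)
    have h4 : d * μ * (l ^ 2 * y ^ 2) ≤ d * c t * (l ^ 2 * y ^ 2) := by
      have := hp.trans hpd
      gcongr
      exact hc t
    have h5 : p * z ^ 2 ≤ d * z ^ 2 := by gcongr
    have h6 : p * (l ^ 2 * y ^ 2) ≤ d * μ * (l ^ 2 * y ^ 2) := by gcongr
    have h7 := mul_le_mul_of_nonneg_left h2 hp
    have h8 : 0 ≤ d * z ^ 2 := by
      have := hp.trans hpd
      positivity
    linarith
  have hEt : E t ≤ E 0 := hanti (left_mem_Icc.2 (ht.1.trans ht.2)) ht ht.1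
  have hE0 : E 0 ≤ 2 * x₀.2 ^ 2 + (3 * d ^ 2 + M * l ^ 2) * x₀.1 ^ 2 := by
    simp only [hE, h.init]
    have h1 : C 0 * (l ^ 2 * x₀.1 ^ 2) ≤ M * (l ^ 2 * x₀.1 ^ 2) := by
      gcongr
      exact hCM 0
    nlinarith [sq_nonneg (x₀.2 - d * x₀.1)]
  refine le_trans ?_ (mul_le_mul_of_nonneg_left (hEt.trans hE0) (by positivity))
  set y := (X t).1 with hy
  set z := (X t).2 with hz
  have hEeq : E t = (z + d * y) ^ 2 + C t * (l ^ 2 * y ^ 2) + d ^ 2 * y ^ 2 := by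
    simp only [hE, ← hy, ← hz]
    ring
  have h1 : μ * (l ^ 2 * y ^ 2) ≤ C t * (l ^ 2 * y ^ 2) := by
    gcongr
    exact hCμ t
  have h2 : l ^ 2 * y ^ 2 ≤ 1 / μ * E t := by
    rw [one_div, ← div_eq_inv_mul, le_div_iff₀ hμ, hEeq]
    nlinarith [sq_nonneg (z + d * y), sq_nonneg (d * y)]
  have h3 : z ^ 2 ≤ 2 * E t := by
    have : 0 ≤ μ * (l ^ 2 * y ^ 2) := by positivity
    rw [hEeq]
    nlinarith [sq_nonneg (z + 2 * d * y)]
  linarith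

/-- A Hölder coefficient has averages at scale `1 / l` which approximate it well enough for
the energy estimate. -/
lemma exists_average {κ σ l : ℝ} (hl : 0 ≤ l) (hσ : σ ≤ 1 / 2)
    (hκ : 0 ≤ κ) (hc : Continuous c) (hcμ : ∀ t, μ ≤ c t) (hcM : ∀ t, c t ≤ M)
    (hcκ : ∀ s t, |c s - c t| ≤ κ * |s - t| ^ (1 - 2 * σ)) :
    ∃ C C' : ℝ → ℝ, (∀ t, HasDerivAt C (C' t) t) ∧ (∀ t, μ ≤ C t) ∧ (∀ t, C t ≤ M) ∧
      (∀ t, |C t - c t| * l ≤ κ * l ^ (2 * σ)) ∧ ∀ t, |C' t| ≤ κ * l ^ (2 * σ) := by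
  have hμM : μ ≤ M := (hcμ 0).trans (hcM 0)
  rcases hl.eq_or_lt with rfl | hl
  · refine ⟨fun _ => μ, fun _ => 0, fun t => hasDerivAt_const t μ, fun _ => le_rfl,
      fun _ => hμM, fun t => ?_, fun t => ?_⟩ <;> simp <;> positivity
  have hint : ∀ a b, IntervalIntegrable c volume a b := fun a b => hc.intervalIntegrable a b
  have hlen : ∀ t : ℝ, t + 1 / l - t = 1 / l := fun t => by ring
  have hle : ∀ t : ℝ, t ≤ t + 1 / l := fun t => by
    have : 0 < 1 / l := by positivity
    linarith
  have hscale : l * (κ * (1 / l) ^ (1 - 2 * σ)) = κ * l ^ (2 * σ) := by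
    have : l ^ (2 * σ) = l * (1 / l) ^ (1 - 2 * σ) := by
      rw [one_div, Real.inv_rpow hl.le, ← Real.rpow_neg hl.le]
      nth_rewrite 2 [← Real.rpow_one l]
      rw [← Real.rpow_add hl]
      congr 1
      ring
    rw [this]
    ring
  refine ⟨fun t => l * ∫ s in t..(t + 1 / l), c s, fun t => l * (c (t + 1 / l) - c t),
    fun t => ?_, fun t => ?_, fun t => ?_, fun t => ?_, fun t => ?_⟩
  · have hprim : ∀ t, HasDerivAt (fun x => ∫ s in (0:ℝ)..x, c s) (c t) t := fun t =>
      intervalIntegral.integral_hasDerivAt_right (hint 0 t)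
        (hc.stronglyMeasurableAtFilter _ _) hc.continuousAt
    have h1 := (((hprim (t + 1 / l)).comp_add_const t (1 / l)).sub (hprim t)).const_mul l
    refine h1.congr_of_eventuallyEq (Eventually.of_forall fun x => ?_)
    simp only [Pi.sub_apply]
    rw [intervalIntegral.integral_interval_sub_left (hint _ _) (hint _ _)]
  · have := intervalIntegral.integral_mono_on (hle t) (intervalIntegrable_const (c := μ))
      (hint _ _) (fun x _ => hcμ x)
    rw [intervalIntegral.integral_const, hlen, smul_eq_mul] at this
    calc μ = l * (1 / l * μ) := by field_simp
      _ ≤ _ := mul_le_mul_of_nonneg_left this hl.le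
  · have := intervalIntegral.integral_mono_on (hle t) (hint _ _)
      (intervalIntegrable_const (c := M)) (fun x _ => hcM x)
    rw [intervalIntegral.integral_const, hlen, smul_eq_mul] at this
    calc _ ≤ l * (1 / l * M) := mul_le_mul_of_nonneg_left this hl.le
      _ = M := by field_simp
  · have h1 : l * (∫ s in t..(t + 1 / l), c s) - c t
        = l * ∫ s in t..(t + 1 / l), (c s - c t) := by
      rw [intervalIntegral.integral_sub (hint _ _) intervalIntegrable_const,
        intervalIntegral.integral_const, hlen, smul_eq_mul]
      field_simp
    have h2 : ‖∫ s in t..(t + 1 / l), (c s - c t)‖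
        ≤ κ * (1 / l) ^ (1 - 2 * σ) * |t + 1 / l - t| := by
      refine intervalIntegral.norm_integral_le_of_norm_le_const fun s hs => ?_
      rw [uIoc_of_le (hle t)] at hs
      refine (hcκ s t).trans ?_
      have h3 : |s - t| ≤ 1 / l := by
        rw [abs_of_nonneg (by linarith [hs.1])]
        linarith [hs.2]
      have h4 : 0 ≤ 1 - 2 * σ := by linarith
      gcongr
    rw [hlen, abs_of_pos (by positivity : 0 < 1 / l), Real.norm_eq_abs] at h2
    rw [h1, abs_mul, abs_of_pos hl, ← hscale]
    calc _ ≤ l * (κ * (1 / l) ^ (1 - 2 * σ) * (1 / l)) * l := by gcongr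
      _ = _ := by field_simp
  · have := hcκ (t + 1 / l) t
    rw [hlen, abs_of_pos (by positivity : 0 < 1 / l)] at this
    rw [abs_mul, abs_of_pos hl, ← hscale]
    gcongr

/-- Uniform-in-frequency energy bound for the damped oscillator whose coefficient has a small
`(1 - 2σ)`-Hölder constant. -/
lemma IsOscSol.energy_le_of_holder {δ κ σ l : ℝ} {x₀ : ℝ × ℝ} {X : ℝ → ℝ × ℝ}
    (h : IsOscSol (2 * δ * l ^ (2 * σ)) (l ^ 2) c T x₀ X) (hμ : 0 < μ) (hl : 0 ≤ l)
    (hσ0 : 0 < σ) (hσ : σ ≤ 1 / 2) (hκ : 0 ≤ κ) (hκδ : κ ≤ δ) (hκμ : κ ≤ δ * μ)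
    (hc : Continuous c) (hcμ : ∀ t, μ ≤ c t) (hcM : ∀ t, c t ≤ M)
    (hcκ : ∀ s t, |c s - c t| ≤ κ * |s - t| ^ (1 - 2 * σ)) {t : ℝ} (ht : t ∈ Icc 0 T) :
    (X t).2 ^ 2 + l ^ 2 * (X t).1 ^ 2 ≤
      (2 + 1 / μ) * (2 + 3 * δ ^ 2 + M) * (x₀.2 ^ 2 + (1 + l ^ 2) * x₀.1 ^ 2) := by
  obtain ⟨C, C', hC, hCμ, hCM, hCc, hC'⟩ := exists_average hl hσ hκ hc hcμ hcM hcκ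
  have hq : 0 ≤ l ^ (2 * σ) := Real.rpow_nonneg hl _
  have hM : 0 ≤ M := hμ.le.trans ((hcμ 0).trans (hcM 0))
  rw [mul_assoc 2] at h
  refine (h.energy_le hμ hl (mul_le_mul_of_nonneg_right hκδ hq)
    (by rw [mul_right_comm]; exact mul_le_mul_of_nonneg_right hκμ hq) hcμ
    (fun t _ => (hC t).hasDerivWithinAt) hCμ hCM hCc hC' ht).trans ?_
  rw [mul_assoc (2 + 1 / μ)]
  refine mul_le_mul_of_nonneg_left ?_ (by positivity)
  have hq2 : (l ^ (2 * σ)) ^ 2 ≤ 1 + l ^ 2 := by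
    rcases le_total l 1 with h1 | h1
    · have : l ^ (2 * σ) ≤ 1 := Real.rpow_le_one hl h1 (by linarith)
      nlinarith [sq_nonneg l]
    · have : l ^ (2 * σ) ≤ l := by
        calc l ^ (2 * σ) ≤ l ^ (1 : ℝ) := Real.rpow_le_rpow_of_exponent_le h1 (by linarith)
          _ = l := Real.rpow_one l
      nlinarith
  have h1 : (δ * l ^ (2 * σ)) ^ 2 * x₀.1 ^ 2 ≤ δ ^ 2 * ((1 + l ^ 2) * x₀.1 ^ 2) := by
    rw [mul_pow, mul_assoc]
    gcongr
  have h2 : M * l ^ 2 * x₀.1 ^ 2 ≤ M * ((1 + l ^ 2) * x₀.1 ^ 2) := by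
    rw [mul_assoc]
    gcongr
    linarith
  have h3 : 0 ≤ (3 * δ ^ 2 + M) * x₀.2 ^ 2 := by positivity
  have h4 : 0 ≤ (1 + l ^ 2) * x₀.1 ^ 2 := by positivity
  nlinarith

end Energy

section Moduli

lemma IsOscSol.abs_sq_sub_sq_le {a l T B : ℝ} {c : ℝ → ℝ} {x₀ : ℝ × ℝ} {X : ℝ → ℝ × ℝ}
    (h : IsOscSol a (l ^ 2) c T x₀ X) (hl : 0 ≤ l)
    (hB : ∀ t ∈ Icc 0 T, (X t).2 ^ 2 + l ^ 2 * (X t).1 ^ 2 ≤ B) {s t : ℝ}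
    (hs : s ∈ Icc 0 T) (ht : t ∈ Icc 0 T) :
    |l ^ 2 * (X s).1 ^ 2 - l ^ 2 * (X t).1 ^ 2| ≤ B * min 1 (l * |s - t|) := by
  have hB0 : 0 ≤ B := le_trans (by positivity) (hB t ht)
  rw [mul_min_of_nonneg _ _ hB0, mul_one]
  refine le_min (abs_sub_le_of_nonneg_of_le (by positivity) ?_ (by positivity) ?_) ?_
  · linarith [hB s hs, sq_nonneg (X s).2]
  · linarith [hB t ht, sq_nonneg (X t).2]
  · have hder : ∀ r ∈ Icc 0 T, HasDerivWithinAt (fun r => l ^ 2 * (X r).1 ^ 2)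
        (l ^ 2 * (2 * (X r).1 * (X r).2)) (Icc 0 T) r := fun r hr => by
      refine (((h.hasDerivWithinAt_fst hr).pow 2).const_mul (l ^ 2)).congr_deriv ?_
      push_cast
      ring
    have := (convex_Icc 0 T).norm_image_sub_le_of_norm_hasDerivWithin_le (C := B * l) hder
      (fun r hr => ?_) ht hs
    · simpa only [Real.norm_eq_abs, mul_assoc] using this
    · have h1 : |l ^ 2 * (2 * (X r).1 * (X r).2)| = l * (2 * (|l * (X r).1| * |(X r).2|)) := by
        simp only [abs_mul, abs_pow, abs_of_nonneg hl, abs_two]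
        ring
      have h2 := sq_nonneg (|l * (X r).1| - |(X r).2|)
      have e1 := sq_abs (l * (X r).1)
      have e2 := sq_abs (X r).2
      rw [Real.norm_eq_abs, h1, mul_comm B]
      refine mul_le_mul_of_nonneg_left ?_ hl
      nlinarith [hB r hr]

lemma min_one_le_rpow {x γ : ℝ} (hx : 0 ≤ x) (hγ0 : 0 ≤ γ) (hγ1 : γ ≤ 1) :
    min 1 x ≤ x ^ γ := by
  rcases le_total 1 x with h | h
  · exact (min_le_left _ _).trans (Real.one_le_rpow h hγ0)
  · refine (min_le_right _ _).trans ?_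
    rcases hx.eq_or_lt with rfl | hx
    · exact Real.rpow_nonneg le_rfl _
    · calc x = x ^ (1 : ℝ) := (Real.rpow_one x).symm
        _ ≤ x ^ γ := Real.rpow_le_rpow_of_exponent_ge hx h hγ1

variable {lam e : ℕ → ℝ}

lemma summable_mul_min (hlam : ∀ k, 0 ≤ lam k) (he0 : ∀ k, 0 ≤ e k) (he : Summable e) {r : ℝ}
    (hr : 0 ≤ r) : Summable fun k => e k * min 1 (lam k * r) := by
  refine he.of_nonneg_of_le (fun k => ?_) fun k => ?_
  · have := hlam k
    have := he0 k
    positivity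
  · exact mul_le_of_le_one_right (he0 k) (min_le_left _ _)

lemma tendsto_tsum_mul_min (hlam : ∀ k, 0 ≤ lam k) (he0 : ∀ k, 0 ≤ e k) (he : Summable e) :
    Tendsto (fun r => ∑' k, e k * min 1 (lam k * r)) (𝓝[≥] 0) (𝓝 0) := by
  have := tendsto_tsum_of_dominated_convergence (𝓕 := 𝓝[≥] (0:ℝ))
    (f := fun r k => e k * min 1 (lam k * r)) (g := fun _ => (0:ℝ)) he (fun k => ?_) ?_
  · simpa using this
  · have : Continuous fun r : ℝ => e k * min 1 (lam k * r) := by fun_prop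
    simpa using (this.tendsto 0).mono_left nhdsWithin_le_nhds
  · filter_upwards [self_mem_nhdsWithin] with r (hr : 0 ≤ r) k
    have := hlam k
    have := he0 k
    rw [Real.norm_of_nonneg (by positivity)]
    exact mul_le_of_le_one_right (he0 k) (min_le_left _ _)

/-- The modulus `r ↦ ∑ e k min(1, lam k r)` is `o(r ^ γ)` as soon as `∑ lam k ^ γ e k`
converges, for `γ < 1`. -/
lemma exists_forall_tsum_mul_min_le {γ ρ : ℝ} (hlam : ∀ k, 0 ≤ lam k) (he0 : ∀ k, 0 ≤ e k)
    (heγ : Summable fun k => lam k ^ γ * e k) (hγ0 : 0 ≤ γ) (hγ1 : γ < 1) (hρ : 0 < ρ) :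
    ∃ T : ℝ, 0 < T ∧ T ≤ 1 ∧ ∀ r ∈ Icc 0 T, ∑' k, e k * min 1 (lam k * r) ≤ ρ * r ^ γ := by
  have hlim : Tendsto (fun r : ℝ => ∑' k, e k * min 1 (lam k * r) / r ^ γ) (𝓝[>] 0) (𝓝 0) := by
    have := tendsto_tsum_of_dominated_convergence (𝓕 := 𝓝[>] (0:ℝ))
      (f := fun r k => e k * min 1 (lam k * r) / r ^ γ) (g := fun _ => (0:ℝ)) heγ (fun k => ?_) ?_
    · simpa using this
    · have h0 : Tendsto (fun r : ℝ => e k * lam k * r ^ (1 - γ)) (𝓝[>] 0) (𝓝 0) := by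
        have hc := (Real.continuousAt_rpow_const 0 (1 - γ) (Or.inr (by linarith))).tendsto
        rw [Real.zero_rpow (by linarith)] at hc
        simpa using (hc.mono_left nhdsWithin_le_nhds).const_mul (e k * lam k)
      refine tendsto_of_tendsto_of_tendsto_of_le_of_le' tendsto_const_nhds h0 ?_ ?_
      · filter_upwards [self_mem_nhdsWithin] with r (hr : 0 < r)
        have := hlam k
        have := he0 k
        positivity
      · filter_upwards [self_mem_nhdsWithin] with r (hr : 0 < r)
        rw [Real.rpow_sub hr, Real.rpow_one, ← mul_div_assoc, mul_assoc]
        have := he0 k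
        gcongr
        exact min_le_right _ _
    · filter_upwards [self_mem_nhdsWithin] with r (hr : 0 < r) k
      have h1 := hlam k
      have h2 := he0 k
      rw [Real.norm_of_nonneg (by positivity), div_le_iff₀ (by positivity)]
      calc e k * min 1 (lam k * r) ≤ e k * (lam k * r) ^ γ := by
            gcongr
            exact min_one_le_rpow (by positivity) hγ0 hγ1.le
        _ = lam k ^ γ * e k * r ^ γ := by
            rw [Real.mul_rpow h1 hr.le]
            ring
  obtain ⟨u, hu, hur⟩ := mem_nhdsGT_iff_exists_Ioc_subset.1
    (hlim.eventually (eventually_le_nhds hρ))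
  refine ⟨min u 1, lt_min hu one_pos, min_le_right _ _, fun r hr => ?_⟩
  rcases hr.1.eq_or_lt with rfl | hr0
  · simp only [mul_zero, zero_le_one, min_eq_right, tsum_zero]
    positivity
  · have := hur ⟨hr0, hr.2.trans (min_le_left _ _)⟩
    rw [mem_ofPred_eq, tsum_div_const, div_le_iff₀ (by positivity)] at this
    exact this

/-- The subcriticality assumption on the modulus makes `ω (ρ r ^ (4α))` a `(1 - 2σ)`-Hölder
modulus with small constant, for small `ρ`. -/
lemma IsModulus.exists_comp_rpow_le {ω : ℝ → ℝ} (hω : IsModulus ω) {σ α κ : ℝ}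
    (hσ : σ ≤ 1 / 2) (hα0 : 0 ≤ α)
    (hlimsup : ∃ C : ℝ, ∀ᶠ x in 𝓝[>] (0:ℝ), ω x ^ (4 * α) / x ^ (1 - 2 * σ) ≤ C)
    (hκ : 0 < κ) :
    ∃ ρ : ℝ, 0 < ρ ∧ ∀ r ∈ Icc (0:ℝ) 1, ω (ρ * r ^ (4 * α)) ≤ κ * r ^ (1 - 2 * σ) := by
  obtain ⟨hcont, hω0, hpos, hmono, -⟩ := hω
  obtain ⟨C, hC⟩ := hlimsup
  rcases hσ.eq_or_lt with rfl | hσ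
  · have h1 : Tendsto ω (𝓝[≥] 0) (𝓝 0) := by
      simpa only [hω0] using (hcont 0 self_mem_Ici).tendsto
    have h2 := (h1.mono_left (nhdsWithin_mono 0 Ioi_subset_Ici_self)).eventually
      (eventually_le_nhds hκ)
    obtain ⟨ρ, hρ, hρ0⟩ := (h2.and self_mem_nhdsWithin).exists
    replace hρ0 : 0 < ρ := hρ0
    refine ⟨ρ, hρ0, fun r hr => ?_⟩
    have h3 : r ^ (4 * α) ≤ 1 := Real.rpow_le_one hr.1 hr.2 (by positivity)
    have h4 : 0 ≤ r ^ (4 * α) := Real.rpow_nonneg hr.1 _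
    norm_num
    exact (hmono _ ρ (by positivity) (mul_le_of_le_one_right hρ0.le h3)).trans hρ
  have hβ : 0 < 1 - 2 * σ := by linarith
  have hα : 0 < α := by
    refine hα0.lt_of_ne' fun hα => ?_
    subst hα
    have h1 : Tendsto (fun x : ℝ => C * x ^ (1 - 2 * σ)) (𝓝[>] 0) (𝓝 0) := by
      have hc := (Real.continuousAt_rpow_const 0 (1 - 2 * σ) (Or.inr hβ.le)).tendsto
      rw [Real.zero_rpow hβ.ne'] at hc
      simpa using (hc.mono_left nhdsWithin_le_nhds).const_mul C
    obtain ⟨x, hx, hx1, hx0⟩ := (hC.and ((h1.eventually (eventually_lt_nhds one_pos)).and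
      self_mem_nhdsWithin)).exists
    replace hx0 : 0 < x := hx0
    rw [mul_zero, Real.rpow_zero, div_le_iff₀ (by positivity)] at hx
    linarith
  set D : ℝ := max C 1 with hD
  have hD0 : 0 < D := lt_max_of_lt_right one_pos
  have hγ : 0 < 4 * α := by positivity
  obtain ⟨u, hu, hur⟩ := mem_nhdsGT_iff_exists_Ioc_subset.1 hC
  replace hu : 0 < u := hu
  have hle : ∀ x ∈ Ioc 0 u, ω x ^ (4 * α) ≤ D * x ^ (1 - 2 * σ) := fun x hx => by
    have h1 := hur hx
    have hx0 := hx.1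
    rw [mem_ofPred_eq, div_le_iff₀ (by positivity)] at h1
    refine h1.trans ?_
    gcongr
    exact le_max_left _ _
  have hlim : Tendsto (fun ρ : ℝ => D * ρ ^ (1 - 2 * σ)) (𝓝[>] 0) (𝓝 0) := by
    have hc := (Real.continuousAt_rpow_const 0 (1 - 2 * σ) (Or.inr hβ.le)).tendsto
    rw [Real.zero_rpow hβ.ne'] at hc
    simpa using (hc.mono_left nhdsWithin_le_nhds).const_mul D
  obtain ⟨ρ, hρκ, hρ⟩ := ((hlim.eventually (eventually_le_nhds
    (by positivity : 0 < κ ^ (4 * α)))).and (Ioc_mem_nhdsGT hu)).exists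
  have hρ0 : 0 < ρ := hρ.1
  refine ⟨ρ, hρ0, fun r hr => ?_⟩
  rcases hr.1.eq_or_lt with rfl | hr0
  · rw [Real.zero_rpow hγ.ne', mul_zero, hω0, Real.zero_rpow hβ.ne', mul_zero]
  have hr1 : r ^ (4 * α) ≤ 1 := Real.rpow_le_one hr.1 hr.2 hγ.le
  have hx0 : 0 < ρ * r ^ (4 * α) := by positivity
  have key := hle _ ⟨hx0, (mul_le_of_le_one_right hρ0.le hr1).trans hρ.2⟩
  refine (Real.rpow_le_rpow_iff (hpos _ hx0).le (by positivity) hγ).1 (key.trans ?_)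
  rw [Real.mul_rpow hρ0.le (by positivity), Real.mul_rpow hκ.le (by positivity), ← mul_assoc,
    ← Real.rpow_mul hr0.le, ← Real.rpow_mul hr0.le, mul_comm (4 * α)]
  gcongr

end Moduli

section FixedPoint

/-- The functions with values in `[μ, M]` that admit `w` as modulus of continuity. -/
def coeffSet (μ M : ℝ) (w : ℝ → ℝ) : Set (ℝ → ℝ) :=
  {c | (∀ t, c t ∈ Icc μ M) ∧ ∀ s t, |c s - c t| ≤ w |s - t|}

variable {μ M T : ℝ} {w : ℝ → ℝ}

lemma tendsto_abs_sub_nhdsGE {ι : Type*} {l : Filter ι} {f : ι → ℝ} {t : ℝ}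
    (h : Tendsto f l (𝓝 t)) : Tendsto (fun i => |f i - t|) l (𝓝[≥] 0) := by
  refine tendsto_nhdsWithin_iff.2 ⟨?_, Eventually.of_forall fun i => mem_Ici.2 (abs_nonneg _)⟩
  simpa using (h.sub_const t).abs

lemma continuous_of_mem_coeffSet (hw : Tendsto w (𝓝[≥] 0) (𝓝 0)) {c : ℝ → ℝ}
    (hc : c ∈ coeffSet μ M w) : Continuous c := by
  refine continuous_iff_continuousAt.2 fun t => tendsto_iff_dist_tendsto_zero.2 ?_
  exact squeeze_zero (fun _ => dist_nonneg) (fun s => hc.2 s t)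
    (hw.comp (tendsto_abs_sub_nhdsGE tendsto_id))

/-- Sequential compactness of `coeffSet` for uniform convergence on `[0, T]`. -/
lemma exists_subseq_coeffSet (hT : 0 ≤ T) (hw : Tendsto w (𝓝[≥] 0) (𝓝 0))
    (hwm : MonotoneOn w (Ici 0)) {c : ℕ → ℝ → ℝ} (hc : ∀ n, c n ∈ coeffSet μ M w) :
    ∃ c' ∈ coeffSet μ M w, ∃ φ : ℕ → ℕ, StrictMono φ ∧
      ∀ ε > 0, ∀ᶠ n in atTop, ∀ t ∈ Icc 0 T, |c (φ n) t - c' t| ≤ ε := by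
  let A : Set (BoundedContinuousFunction (Icc 0 T) ℝ) :=
    {f | (∀ t, f t ∈ Icc μ M) ∧ ∀ s t : Icc 0 T, |f s - f t| ≤ w |(s : ℝ) - t|}
  have hclosed : IsClosed A := by
    have h1 : ∀ t : Icc 0 T, Continuous fun f : BoundedContinuousFunction (Icc 0 T) ℝ => f t :=
      fun t => continuous_eval_const t
    have : A = (⋂ t : Icc 0 T, {f | f t ∈ Icc μ M}) ∩
        ⋂ s : Icc 0 T, ⋂ t : Icc 0 T, {f | |f s - f t| ≤ w |(s : ℝ) - t|} := by
      ext f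
      simp only [A, mem_ofPred_eq, mem_inter_iff, mem_iInter]
    rw [this]
    refine (isClosed_iInter fun t => isClosed_Icc.preimage (h1 t)).inter
      (isClosed_iInter fun s => isClosed_iInter fun t =>
        isClosed_le ((h1 s).sub (h1 t)).abs continuous_const)
  have hequi : Equicontinuous ((↑) : A → Icc 0 T → ℝ) := by
    intro t
    rw [Metric.equicontinuousAt_iff_right]
    intro ε hε
    have h1 : Tendsto (fun s : Icc 0 T => w |(s : ℝ) - t|) (𝓝 t) (𝓝 0) :=
      hw.comp (tendsto_abs_sub_nhdsGE continuous_subtype_val.continuousAt)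
    filter_upwards [h1.eventually (eventually_lt_nhds hε)] with s hs f
    rw [dist_comm]
    exact (f.2.2 s t).trans_lt hs
  have hcomp : IsCompact A :=
    BoundedContinuousFunction.arzela_ascoli₂ (Icc μ M) isCompact_Icc A hclosed
      (fun f t hf => hf.1 t) hequi
  let f : ℕ → BoundedContinuousFunction (Icc 0 T) ℝ := fun n =>
    BoundedContinuousFunction.mkOfCompact
      ⟨fun t : Icc 0 T => c n t, (continuous_of_mem_coeffSet hw (hc n)).comp continuous_subtype_val⟩
  have hf : ∀ n, f n ∈ A := fun n => ⟨fun t => (hc n).1 t, fun s t => (hc n).2 s t⟩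
  obtain ⟨g, hg, φ, hφ, hlim⟩ := hcomp.tendsto_subseq hf
  refine ⟨fun t => g (projIcc 0 T hT t), ⟨fun t => hg.1 _, fun s t => ?_⟩, φ, hφ,
    fun ε hε => ?_⟩
  · refine (hg.2 _ _).trans (hwm (mem_Ici.2 (abs_nonneg _)) (mem_Ici.2 (abs_nonneg _)) ?_)
    rw [coe_projIcc, coe_projIcc]
    refine (abs_max_sub_max_le_max _ _ _ _).trans ?_
    rw [sub_self, abs_zero]
    refine max_le (abs_nonneg _) ((abs_min_sub_min_le_max _ _ _ _).trans ?_)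
    simp
  · filter_upwards [(tendsto_iff_dist_tendsto_zero.1 hlim).eventually (eventually_le_nhds hε)]
      with n hn t ht
    have h2 := (BoundedContinuousFunction.dist_coe_le_dist (f := f (φ n)) (g := g) ⟨t, ht⟩).trans hn
    rw [projIcc_of_mem hT ht]
    exact h2

/-- A causal and continuous operator on coefficients, mapping `coeffSet μ M w` to itself, has a
fixed point on `[0, T]`: solve the equation with a small delay and let the delay vanish. -/
lemma exists_fixedPoint_of_causal (hT : 0 ≤ T) (hμM : μ ≤ M) (hw : Tendsto w (𝓝[≥] 0) (𝓝 0))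
    (hwm : MonotoneOn w (Ici 0)) (hw0 : 0 ≤ w 0) (F : (ℝ → ℝ) → ℝ → ℝ)
    (hF : ∀ c ∈ coeffSet μ M w, ∀ t ∈ Icc 0 T, F c t ∈ Icc μ M)
    (hFw : ∀ c ∈ coeffSet μ M w, ∀ s ∈ Icc 0 T, ∀ t ∈ Icc 0 T, |F c s - F c t| ≤ w |s - t|)
    (hcausal : ∀ c ∈ coeffSet μ M w, ∀ c' ∈ coeffSet μ M w, ∀ S ∈ Icc 0 T,
      (∀ t ∈ Ico 0 S, c t = c' t) → F c S = F c' S)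
    (hcont : ∀ c : ℕ → ℝ → ℝ, (∀ n, c n ∈ coeffSet μ M w) → ∀ c' ∈ coeffSet μ M w,
      (∀ ε > 0, ∀ᶠ n in atTop, ∀ t ∈ Icc 0 T, |c n t - c' t| ≤ ε) →
      ∀ τ : ℕ → ℝ, (∀ n, τ n ∈ Icc 0 T) → ∀ t ∈ Icc 0 T, Tendsto τ atTop (𝓝 t) →
        Tendsto (fun n => F (c n) (τ n)) atTop (𝓝 (F c' t))) :
    ∃ c ∈ coeffSet μ M w, ∀ t ∈ Icc 0 T, c t = F c t := by
  have hclamp : ∀ t, max 0 (min T t) ∈ Icc 0 T := fun t =>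
    ⟨le_max_left _ _, max_le hT (min_le_left _ _)⟩
  have hclamp_sub : ∀ s t : ℝ, |max 0 (min T s) - max 0 (min T t)| ≤ |s - t| := fun s t => by
    refine (abs_max_sub_max_le_max _ _ _ _).trans ?_
    rw [sub_self, abs_zero]
    refine max_le (abs_nonneg _) ((abs_min_sub_min_le_max _ _ _ _).trans ?_)
    simp
  have hdelay : ∀ h > 0, ∃ c ∈ coeffSet μ M w,
      ∀ t ∈ Icc 0 T, c t = F c (max 0 (min T (t - h))) := by
    intro h hh
    let step : (ℝ → ℝ) → ℝ → ℝ := fun c t => F c (max 0 (min T (t - h)))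
    have hstep : ∀ c ∈ coeffSet μ M w, step c ∈ coeffSet μ M w := fun c hc =>
      ⟨fun t => hF c hc _ (hclamp _), fun s t => (hFw c hc _ (hclamp _) _ (hclamp _)).trans
        (hwm (mem_Ici.2 (abs_nonneg _)) (mem_Ici.2 (abs_nonneg _)) ((hclamp_sub _ _).trans (by simp)))⟩
    let c : ℕ → ℝ → ℝ := fun n => step^[n] fun _ => μ
    have hcs : ∀ n, c (n + 1) = step (c n) := fun n => Function.iterate_succ_apply' _ _ _
    have hc : ∀ n, c n ∈ coeffSet μ M w := by
      intro n
      induction n with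
      | zero =>
        refine ⟨fun t => ⟨le_rfl, hμM⟩, fun s t => ?_⟩
        simpa [c] using hw0.trans (hwm self_mem_Ici (mem_Ici.2 (abs_nonneg (s - t))) (abs_nonneg _))
      | succ n ih =>
        rw [hcs]
        exact hstep _ ih
    have hagree : ∀ n : ℕ, ∀ t ∈ Ico 0 (n * h), c n t = c (n + 1) t := by
      intro n
      induction n with
      | zero =>
        intro t ht
        simp at ht
      | succ n ih =>
        intro t ht
        rw [hcs n, hcs (n + 1)]
        refine hcausal _ (hc n) _ (hc (n + 1)) _ (hclamp _) fun r hr => ih r ⟨hr.1, ?_⟩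
        have h1 := ht.2
        push_cast at h1
        rcases lt_max_iff.1 hr.2 with h2 | h2
        · exact absurd hr.1 (not_le.2 h2)
        · linarith [h2.trans_le (min_le_right _ _)]
    obtain ⟨n, hn⟩ := exists_nat_gt (T / h)
    rw [div_lt_iff₀ hh] at hn
    refine ⟨c n, hc n, fun t ht => ?_⟩
    rw [hagree n t ⟨ht.1, ht.2.trans_lt hn⟩, hcs]
  choose! cd hcd hcd' using hdelay
  obtain ⟨c, hc, φ, hφ, hlim⟩ := exists_subseq_coeffSet hT hw hwm
    (c := fun n => cd (1 / ((n : ℝ) + 1))) (fun n => hcd _ (by positivity))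
  refine ⟨c, hc, fun t ht => ?_⟩
  have hh : Tendsto (fun n => 1 / ((φ n : ℝ) + 1)) atTop (𝓝 0) :=
    tendsto_one_div_add_atTop_nhds_zero_nat.comp hφ.tendsto_atTop
  have hτ : Tendsto (fun n => max 0 (min T (t - 1 / ((φ n : ℝ) + 1)))) atTop (𝓝 t) := by
    have := (tendsto_const_nhds (x := (0:ℝ))).max
      ((tendsto_const_nhds (x := T)).min (hh.const_sub t))
    simpa [ht.1, ht.2] using this
  have h1 := hcont _ (fun n => hcd (1 / ((φ n : ℝ) + 1)) (by positivity)) c hc hlim _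
    (fun n => hclamp _) t ht hτ
  have h2 : Tendsto (fun n => cd (1 / ((φ n : ℝ) + 1)) t) atTop (𝓝 (c t)) := by
    refine Metric.tendsto_nhds.2 fun ε hε => ?_
    filter_upwards [hlim (ε / 2) (half_pos hε)] with n hn
    exact (hn t ht).trans_lt (half_lt_self hε)
  refine tendsto_nhds_unique h2 (h1.congr fun n => ?_)
  exact (hcd' _ (by positivity) t ht).symm

end FixedPoint

lemma L2Cont.of_summable_bound {I : Set ℝ} {v : ℝ → ℕ → ℝ} {b : ℕ → ℝ} (hb : Summable b)
    (hv : ∀ k, ContinuousOn (fun t => v t k) I) (hvb : ∀ t ∈ I, ∀ k, v t k ^ 2 ≤ b k) :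
    L2Cont I v := by
  refine ⟨fun t ht => hb.of_nonneg_of_le (fun k => sq_nonneg _) (hvb t ht), fun t ht ε hε => ?_⟩
  have hlim : Tendsto (fun s => ∑' k, (v s k - v t k) ^ 2) (𝓝[I] t) (𝓝 0) := by
    have := tendsto_tsum_of_dominated_convergence (𝓕 := 𝓝[I] t)
      (f := fun s k => (v s k - v t k) ^ 2) (g := fun _ => (0:ℝ)) (hb.mul_left 4) (fun k => ?_) ?_
    · simpa using this
    · simpa using (((hv k) t ht).tendsto.sub_const (v t k)).pow 2
    · filter_upwards [self_mem_nhdsWithin] with s hs k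
      rw [Real.norm_of_nonneg (sq_nonneg _)]
      nlinarith [hvb s hs k, hvb t ht k, sq_nonneg (v s k + v t k)]
  obtain ⟨η, hη, h⟩ := Metric.mem_nhdsWithin_iff.1 (hlim.eventually (eventually_lt_nhds hε))
  exact ⟨η, hη, fun s hs hst => h ⟨hst, hs⟩⟩

lemma rpow_le_one_add_rpow {x p q : ℝ} (hx : 0 ≤ x) (hp : 0 ≤ p) (hpq : p ≤ q) :
    x ^ p ≤ 1 + x ^ q := by
  rcases le_total x 1 with h | h
  · have := Real.rpow_le_one hx h hp
    linarith [Real.rpow_nonneg hx q]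
  · linarith [Real.rpow_le_rpow_of_exponent_le h hpq]

lemma summable_energy {lam u0 u1 : ℕ → ℝ} {γ : ℝ} (hlam : ∀ k, 0 ≤ lam k) (hγ : 0 ≤ γ)
    (hu0 : Summable fun k => u0 k ^ 2)
    (hu0' : Summable fun k => lam k ^ (γ + 2) * u0 k ^ 2)
    (hu1 : Summable fun k => u1 k ^ 2)
    (hu1' : Summable fun k => lam k ^ γ * u1 k ^ 2) :
    (Summable fun k => u1 k ^ 2 + (1 + lam k ^ 2) * u0 k ^ 2) ∧
      Summable fun k => lam k ^ γ * (u1 k ^ 2 + (1 + lam k ^ 2) * u0 k ^ 2) := by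
  have h2 : ∀ k, lam k ^ 2 = lam k ^ (2 : ℝ) := fun k => (Real.rpow_two _).symm
  constructor
  · refine (hu1.add ((hu0.mul_left 2).add hu0')).of_nonneg_of_le (fun k => by positivity)
      fun k => ?_
    have := rpow_le_one_add_rpow (hlam k) zero_le_two (by linarith : 2 ≤ γ + 2)
    rw [← h2] at this
    nlinarith [sq_nonneg (u0 k)]
  · refine (hu1'.add (hu0.add (hu0'.mul_left 2))).of_nonneg_of_le
      (fun k => by have := hlam k; positivity) fun k => ?_
    have h3 := rpow_le_one_add_rpow (hlam k) hγ (by linarith : γ ≤ γ + 2)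
    have h4 : lam k ^ (γ + 2) = lam k ^ γ * lam k ^ 2 := by
      rw [h2, Real.rpow_add_of_nonneg (hlam k) hγ zero_le_two]
    nlinarith [mul_le_mul_of_nonneg_right h3 (sq_nonneg (u0 k))]

section Kirchhoff

variable {lam e : ℕ → ℝ} {a : ℕ → ℝ} {u0 u1 : ℕ → ℝ} {μ M T : ℝ}

/-- Joint continuity of `(c, t) ↦ |A^{1/2} u(t)|²`, where `u` solves the linear equation with
coefficient `c`. -/
lemma tendsto_tsum_of_isOscSol (ha : ∀ k, 0 ≤ a k) (he : Summable e)
    {c : ℕ → ℝ → ℝ} {c' : ℝ → ℝ} {X : ℕ → ℕ → ℝ → ℝ × ℝ} {Y : ℕ → ℝ → ℝ × ℝ}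
    (hc : ∀ n t, |c n t| ≤ M) (hc' : ∀ t, |c' t| ≤ M)
    (hX : ∀ n k, IsOscSol (a k) (lam k ^ 2) (c n) T (u0 k, u1 k) (X n k))
    (hY : ∀ k, IsOscSol (a k) (lam k ^ 2) c' T (u0 k, u1 k) (Y k))
    (hXe : ∀ n k, ∀ t ∈ Icc 0 T, lam k ^ 2 * (X n k t).1 ^ 2 ≤ e k)
    (hlim : ∀ ε > 0, ∀ᶠ n in atTop, ∀ t ∈ Icc 0 T, |c n t - c' t| ≤ ε)
    {τ : ℕ → ℝ} (hτ : ∀ n, τ n ∈ Icc 0 T) {t : ℝ} (ht : t ∈ Icc 0 T)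
    (hτt : Tendsto τ atTop (𝓝 t)) :
    Tendsto (fun n => ∑' k, lam k ^ 2 * (X n k (τ n)).1 ^ 2) atTop
      (𝓝 (∑' k, lam k ^ 2 * (Y k t).1 ^ 2)) := by
  refine tendsto_tsum_of_dominated_convergence he (fun k => ?_)
    (Eventually.of_forall fun n k => ?_)
  · have hM0 : 0 ≤ M := (abs_nonneg _).trans (hc' 0)
    have hak := ha k
    set K : ℝ := 1 + a k + lam k ^ 2 * M
    have hK : 0 ≤ K := by positivity
    set R : ℝ := ‖(u0 k, u1 k)‖ * Real.exp (K * T)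
    have hR : ∀ t ∈ Icc 0 T, ‖Y k t‖ ≤ R := fun t ht =>
      (hY k).norm_le hak (sq_nonneg _) hc' ht
    have hR0 : 0 ≤ R := (norm_nonneg _).trans (hR t ht)
    have h1 : Tendsto (fun n => Y k (τ n)) atTop (𝓝 (Y k t)) :=
      ((hY k).continuousOn t ht).tendsto.comp
        (tendsto_nhdsWithin_iff.2 ⟨hτt, Eventually.of_forall hτ⟩)
    have h2 : Tendsto (fun n => X n k (τ n) - Y k (τ n)) atTop (𝓝 0) := by
      have h3 : Tendsto (fun ε : ℝ => gronwallBound 0 K (lam k ^ 2 * (ε * R)) T)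
          (𝓝[>] 0) (𝓝 0) := by
        have hcont : Continuous fun ε : ℝ => gronwallBound 0 K (lam k ^ 2 * (ε * R)) T :=
          (gronwallBound_continuous_ε 0 K T).comp (by fun_prop)
        have := (hcont.tendsto 0).mono_left (nhdsWithin_le_nhds (s := Ioi 0))
        simpa [gronwallBound_ε0_δ0] using this
      refine squeeze_zero_norm' (a := fun n => ‖X n k (τ n) - Y k (τ n)‖)
        (Eventually.of_forall fun _ => le_rfl) (Metric.tendsto_nhds.2 fun η hη => ?_)
      obtain ⟨ε, hε, hε0⟩ := ((h3.eventually (eventually_lt_nhds hη)).and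
        self_mem_nhdsWithin).exists
      replace hε0 : 0 < ε := hε0
      filter_upwards [hlim ε hε0] with n hn
      rw [dist_zero_right, norm_norm]
      refine lt_of_le_of_lt ?_ hε
      refine ((hX n k).norm_sub_le (hY k) hak (sq_nonneg _) (hc n) le_rfl hR
        (fun t ht => hn t (Ico_subset_Icc_self ht)) (hτ n)).trans ?_
      exact gronwallBound_mono le_rfl (by positivity) hK (hτ n).2
    have h3 : Tendsto (fun n => X n k (τ n)) atTop (𝓝 (Y k t)) := by
      simpa using h2.add h1
    exact ((continuous_fst.tendsto _).comp h3).pow 2 |>.const_mul _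
  · rw [Real.norm_of_nonneg (by positivity)]
    exact hXe n k _ (hτ n)

end Kirchhoff

/-- Subcritical dissipation: local existence for the Kirchhoff equation with strong
damping `A^σ u'`, `σ ∈ (0,1/2]`, in the phase space `D(A^{α+1/2}) × D(A^α)` determined
by the continuity modulus of `m` and by `σ`. -/
theorem local_existence_subcritical
    (lam : ℕ → ℝ) (hlam : ∀ k, 0 ≤ lam k)
    (μ₁ : ℝ) (hμ₁ : 0 < μ₁)
    (m : ℝ → ℝ) (hmlb : ∀ x : ℝ, 0 ≤ x → μ₁ ≤ m x)
    (ωm : ℝ → ℝ) (hωm : IsModulus ωm)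
    (hmc : ∀ a b : ℝ, 0 ≤ a → 0 ≤ b → |m a - m b| ≤ ωm |a - b|)
    (σ δ : ℝ) (hσ0 : 0 < σ) (hσ : σ ≤ 1 / 2) (hδ : 0 < δ)
    (α : ℝ) (hα0 : 0 ≤ α) (hα1 : α < 1 / 4)
    (hlimsup : ∃ C : ℝ, ∀ᶠ x in 𝓝[>] (0:ℝ), ωm x ^ (4 * α) / x ^ (1 - 2 * σ) ≤ C)
    (u0 u1 : ℕ → ℝ)
    (hu0 : Summable fun k => u0 k ^ 2)
    (hu0' : Summable fun k => lam k ^ (4 * α + 2) * u0 k ^ 2)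
    (hu1 : Summable fun k => u1 k ^ 2)
    (hu1' : Summable fun k => lam k ^ (4 * α) * u1 k ^ 2) :
    ∃ T : ℝ, 0 < T ∧ ∃ u : ℕ → ℝ → ℝ,
      IsKirchhoffSol lam m σ δ (Icc 0 T) u0 u1 u ∧
      L2Cont (Icc 0 T) (fun t k => lam k ^ (2 * α + 1) * u k t) ∧
      L2Cont (Icc 0 T) (fun t k => lam k ^ (2 * α) * derivWithin (u k) (Icc 0 T) t) := by
  set e : ℕ → ℝ := fun k => u1 k ^ 2 + (1 + lam k ^ 2) * u0 k ^ 2 with he_def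
  have hα4 : 0 ≤ 4 * α := by positivity
  obtain ⟨he, heα⟩ := summable_energy hlam hα4 hu0 hu0' hu1 hu1'
  set M : ℝ := m (∑' k, lam k ^ 2 * u0 k ^ 2) + 1 with hM_def
  have hμM : μ₁ ≤ M := by
    have := hmlb (∑' k, lam k ^ 2 * u0 k ^ 2) (tsum_nonneg fun k => by positivity)
    linarith
  have hM0 : 0 ≤ M := hμ₁.le.trans hμM
  set B : ℕ → ℝ := fun k => (2 + 1 / μ₁) * (2 + 3 * δ ^ 2 + M) * e k with hB_def
  have hB0 : ∀ k, 0 ≤ B k := fun k => by positivity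
  have hB : Summable B := he.mul_left _
  have hBα : Summable fun k => lam k ^ (4 * α) * B k := by
    refine (heα.mul_left ((2 + 1 / μ₁) * (2 + 3 * δ ^ 2 + M))).congr fun k => ?_
    simp only [hB_def, he_def]
    ring
  set κ : ℝ := min 1 (min δ (δ * μ₁)) with hκ_def
  have hκ : 0 < κ := by positivity
  have hκ1 : κ ≤ 1 := min_le_left _ _
  have hκδ : κ ≤ δ := (min_le_right _ _).trans (min_le_left _ _)
  have hκμ : κ ≤ δ * μ₁ := (min_le_right _ _).trans (min_le_right _ _)
  obtain ⟨ρ, hρ, hωρ⟩ := hωm.exists_comp_rpow_le hσ hα0 hlimsup hκ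
  obtain ⟨T, hT, hT1, hθρ⟩ := exists_forall_tsum_mul_min_le hlam hB0 hBα hα4 (by linarith) hρ
  obtain ⟨hωcont, hω0, -, hωmono, -⟩ := hωm
  set θ : ℝ → ℝ := fun r => ∑' k, B k * min 1 (lam k * r) with hθ_def
  have hθ0 : ∀ r, 0 ≤ r → 0 ≤ θ r := fun r hr => tsum_nonneg fun k => by
    have := hlam k
    have := hB0 k
    positivity
  have hθmono : ∀ r s, 0 ≤ r → r ≤ s → θ r ≤ θ s := fun r s hr hrs =>
    (summable_mul_min hlam hB0 hB hr).tsum_le_tsum (fun k => by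
      have := hlam k
      have := hB0 k
      gcongr) (summable_mul_min hlam hB0 hB (hr.trans hrs))
  have hωnonneg : ∀ r, 0 ≤ r → 0 ≤ ωm r := fun r hr => hω0 ▸ hωmono 0 r le_rfl hr
  have hσ' : 0 ≤ 1 - 2 * σ := by linarith
  set w : ℝ → ℝ := fun r => min (ωm (θ r)) (κ * r ^ (1 - 2 * σ)) with hw_def
  have hωlim : Tendsto ωm (𝓝[≥] 0) (𝓝 0) := by
    simpa only [hω0] using (hωcont 0 self_mem_Ici).tendsto
  have hw : Tendsto w (𝓝[≥] 0) (𝓝 0) := by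
    have h1 : Tendsto (fun r => ωm (θ r)) (𝓝[≥] 0) (𝓝 0) :=
      hωlim.comp (tendsto_nhdsWithin_iff.2 ⟨tendsto_tsum_mul_min hlam hB0 hB, by
        filter_upwards [self_mem_nhdsWithin] with r hr
        exact hθ0 r hr⟩)
    refine squeeze_zero' ?_ (Eventually.of_forall fun r => min_le_left _ _) h1
    filter_upwards [self_mem_nhdsWithin] with r (hr : 0 ≤ r)
    exact le_min (hωnonneg _ (hθ0 r hr)) (by positivity)
  have hwmono : MonotoneOn w (Ici 0) := by
    intro r (hr : 0 ≤ r) s _ hrs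
    refine min_le_min (hωmono _ _ (hθ0 r hr) (hθmono r s hr hrs)) ?_
    gcongr
  have hw0 : 0 ≤ w 0 := le_min (hωnonneg _ (hθ0 0 le_rfl)) (by positivity)
  have ha : ∀ k, 0 ≤ 2 * δ * lam k ^ (2 * σ) := fun k => by
    have := hlam k
    positivity
  -- The solution operator of the linear equation.
  have hex : ∀ (c : ℝ → ℝ) (k : ℕ), ∃ X, c ∈ coeffSet μ₁ M w →
      IsOscSol (2 * δ * lam k ^ (2 * σ)) (lam k ^ 2) c T (u0 k, u1 k) X := by
    intro c k
    by_cases hc : c ∈ coeffSet μ₁ M w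
    · obtain ⟨X, hX⟩ := exists_isOscSol (ha k) (sq_nonneg (lam k))
        (continuous_of_mem_coeffSet hw hc)
        (fun t => abs_le.2 ⟨by linarith [(hc.1 t).1], (hc.1 t).2⟩) hT.le (u0 k, u1 k)
      exact ⟨X, fun _ => hX⟩
    · exact ⟨0, fun h => absurd h hc⟩
  choose X hX using hex
  have habs : ∀ c ∈ coeffSet μ₁ M w, ∀ t, |c t| ≤ M := fun c hc t =>
    abs_le.2 ⟨by linarith [(hc.1 t).1], (hc.1 t).2⟩
  have henergy : ∀ c ∈ coeffSet μ₁ M w, ∀ k, ∀ t ∈ Icc 0 T,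
      (X c k t).2 ^ 2 + lam k ^ 2 * (X c k t).1 ^ 2 ≤ B k := fun c hc k t ht =>
    (hX c k hc).energy_le_of_holder hμ₁ (hlam k) hσ0 hσ hκ.le hκδ hκμ
      (continuous_of_mem_coeffSet hw hc) (fun t => (hc.1 t).1) (fun t => (hc.1 t).2)
      (fun s t => (hc.2 s t).trans (min_le_right _ _)) ht
  have hpot : ∀ c ∈ coeffSet μ₁ M w, ∀ k, ∀ t ∈ Icc 0 T,
      lam k ^ 2 * (X c k t).1 ^ 2 ≤ B k := fun c hc k t ht => by
    linarith [henergy c hc k t ht, sq_nonneg (X c k t).2]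
  set G : (ℝ → ℝ) → ℝ → ℝ := fun c t => ∑' k, lam k ^ 2 * (X c k t).1 ^ 2 with hG_def
  have hG0 : ∀ c t, 0 ≤ G c t := fun c t => tsum_nonneg fun k => by positivity
  have hGsum : ∀ c ∈ coeffSet μ₁ M w, ∀ t ∈ Icc 0 T,
      Summable fun k => lam k ^ 2 * (X c k t).1 ^ 2 := fun c hc t ht =>
    hB.of_nonneg_of_le (fun k => by positivity) fun k => hpot c hc k t ht
  have hGθ : ∀ c ∈ coeffSet μ₁ M w, ∀ s ∈ Icc 0 T, ∀ t ∈ Icc 0 T,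
      |G c s - G c t| ≤ θ |s - t| := fun c hc s hs t ht => by
    have hs1 := summable_mul_min hlam hB0 hB (abs_nonneg (s - t))
    rw [hG_def]
    simp only
    rw [← (hGsum c hc s hs).tsum_sub (hGsum c hc t ht), ← Real.norm_eq_abs]
    exact tsum_of_norm_bounded hs1.hasSum fun k =>
      (hX c k hc).abs_sq_sub_sq_le (hlam k) (henergy c hc k) hs ht
  have hFw : ∀ c ∈ coeffSet μ₁ M w, ∀ s ∈ Icc 0 T, ∀ t ∈ Icc 0 T,
      |m (G c s) - m (G c t)| ≤ w |s - t| := fun c hc s hs t ht => by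
    have hr : |s - t| ∈ Icc 0 T :=
      ⟨abs_nonneg _, abs_sub_le_of_nonneg_of_le hs.1 hs.2 ht.1 ht.2⟩
    have h1 : |m (G c s) - m (G c t)| ≤ ωm (θ |s - t|) :=
      (hmc _ _ (hG0 c s) (hG0 c t)).trans (hωmono _ _ (abs_nonneg _) (hGθ c hc s hs t ht))
    exact le_min h1 (h1.trans ((hωmono _ _ (hθ0 _ hr.1) (hθρ _ hr)).trans
      (hωρ _ ⟨hr.1, hr.2.trans hT1⟩)))
  have h0T : (0:ℝ) ∈ Icc 0 T := left_mem_Icc.2 hT.le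
  have hGinit : ∀ c ∈ coeffSet μ₁ M w, G c 0 = ∑' k, lam k ^ 2 * u0 k ^ 2 := fun c hc =>
    tsum_congr fun k => by rw [(hX c k hc).init]
  have hF : ∀ c ∈ coeffSet μ₁ M w, ∀ t ∈ Icc 0 T, m (G c t) ∈ Icc μ₁ M := fun c hc t ht => by
    refine ⟨hmlb _ (hG0 c t), ?_⟩
    have h1 := (le_abs_self _).trans (hFw c hc t ht 0 h0T)
    have h2 : w |t - 0| ≤ 1 := by
      refine (min_le_right _ _).trans ?_
      rw [sub_zero, abs_of_nonneg ht.1]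
      exact mul_le_one₀ hκ1 (Real.rpow_nonneg ht.1 _)
        (Real.rpow_le_one ht.1 (ht.2.trans hT1) hσ')
    rw [hGinit c hc] at h1
    linarith
  have hmcont : ∀ {y : ℕ → ℝ} {x : ℝ}, (∀ n, 0 ≤ y n) → 0 ≤ x → Tendsto y atTop (𝓝 x) →
      Tendsto (fun n => m (y n)) atTop (𝓝 (m x)) := fun {y x} hy hx hyx => by
    refine tendsto_iff_dist_tendsto_zero.2 ?_
    exact squeeze_zero (fun _ => dist_nonneg) (fun n => hmc _ _ (hy n) hx)
      (hωlim.comp (tendsto_abs_sub_nhdsGE hyx))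
  obtain ⟨c, hc, hcF⟩ := exists_fixedPoint_of_causal hT.le hμM hw hwmono hw0
    (fun c t => m (G c t)) hF hFw
    (fun c hc c' hc' S hS hcc' => by
      have hSk : ∀ k, X c k S = X c' k S := fun k => by
        have h1 := (hX c k hc).norm_sub_le (hX c' k hc') (ha k) (sq_nonneg _) (habs c hc) hS.2
          (fun t ht => (hX c' k hc').norm_le (ha k) (sq_nonneg _) (habs c' hc') ht)
          (ε := 0) (fun t ht => by rw [hcc' t ht, sub_self, abs_zero])
          (right_mem_Icc.2 hS.1)
        rw [zero_mul, mul_zero, gronwallBound_ε0_δ0, norm_le_zero_iff, sub_eq_zero] at h1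
        exact h1
      simp only [hG_def, hSk])
    (fun c hc c' hc' hlim τ hτ t ht hτt => hmcont (fun n => hG0 _ _) (hG0 _ _)
      (tendsto_tsum_of_isOscSol ha hB (fun n => habs _ (hc n)) (habs _ hc')
        (fun n k => hX _ k (hc n)) (fun k => hX _ k hc') (fun n k => hpot _ (hc n) k)
        hlim hτ ht hτt))
  -- The solution with the fixed coefficient solves the nonlinear equation.
  have hsol : ∀ k, IsOscSol (2 * δ * lam k ^ (2 * σ)) (lam k ^ 2) c T (u0 k, u1 k) (X c k) :=
    fun k => hX c k hc
  have huniq : UniqueDiffOn ℝ (Icc 0 T) := uniqueDiffOn_Icc hT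
  have hd1 : ∀ k, ∀ t ∈ Icc 0 T,
      derivWithin (fun t => (X c k t).1) (Icc 0 T) t = (X c k t).2 := fun k t ht =>
    ((hsol k).hasDerivWithinAt_fst ht).derivWithin (huniq t ht)
  have hd2 : ∀ k, ∀ t ∈ Icc 0 T, HasDerivWithinAt
      (derivWithin (fun t => (X c k t).1) (Icc 0 T))
      (-(2 * δ * lam k ^ (2 * σ) * (X c k t).2) - lam k ^ 2 * c t * (X c k t).1)
      (Icc 0 T) t := fun k t ht =>
    ((hsol k).hasDerivWithinAt_snd ht).congr (hd1 k) (hd1 k t ht)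
  have hcont1 : ∀ k, ContinuousOn (fun t => (X c k t).1) (Icc 0 T) := fun k =>
    continuous_fst.comp_continuousOn (hsol k).continuousOn
  have hcont2 : ∀ k, ContinuousOn (fun t => (X c k t).2) (Icc 0 T) := fun k =>
    continuous_snd.comp_continuousOn (hsol k).continuousOn
  have hcontd : ∀ k, ContinuousOn (derivWithin (fun t => (X c k t).1) (Icc 0 T)) (Icc 0 T) :=
    fun k => (hcont2 k).congr (hd1 k)
  have hlamα : ∀ k, (lam k ^ (2 * α)) ^ 2 = lam k ^ (4 * α) := fun k => by
    rw [← Real.rpow_natCast, ← Real.rpow_mul (hlam k)]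
    congr 1
    push_cast
    ring
  have hlamα' : ∀ k, lam k ^ (2 * α + 1) = lam k ^ (2 * α) * lam k := fun k => by
    rw [Real.rpow_add_of_nonneg (hlam k) (by positivity) zero_le_one, Real.rpow_one]
  refine ⟨T, hT, fun k t => (X c k t).1, ⟨fun k => ?_, fun k => ?_, fun k => ?_,
    fun k t ht => ?_, ?_, ?_, ?_⟩, ?_, ?_⟩
  · rw [show (2 : WithTop ℕ∞) = 1 + 1 from rfl, contDiffOn_succ_iff_derivWithin huniq]
    refine ⟨fun t ht => ((hsol k).hasDerivWithinAt_fst ht).differentiableWithinAt, by simp, ?_⟩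
    rw [contDiffOn_one_iff_derivWithin huniq]
    refine ⟨fun t ht => (hd2 k t ht).differentiableWithinAt, ?_⟩
    refine ContinuousOn.congr ?_ fun t ht => (hd2 k t ht).derivWithin (huniq t ht)
    exact ((hcont2 k).const_mul _).neg.sub
      ((((continuous_of_mem_coeffSet hw hc).continuousOn).const_mul _).mul (hcont1 k))
  · simp only [(hsol k).init]
  · rw [hd1 k 0 h0T, (hsol k).init]
  · rw [(hd2 k t ht).derivWithin (huniq t ht), hd1 k t ht, hcF t ht]
    ring
  · refine L2Cont.of_summable_bound (b := fun k => 2 * (u0 k ^ 2 + B k))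
      ((hu0.add hB).mul_left 2) hcont1 fun t ht k => ?_
    have h1 := (convex_Icc 0 T).norm_image_sub_le_of_norm_hasDerivWithin_le
      (C := Real.sqrt (B k)) (fun r hr => (hsol k).hasDerivWithinAt_fst hr)
      (fun r hr => by
        refine Real.abs_le_sqrt ?_
        nlinarith [henergy c hc k r hr, mul_nonneg (sq_nonneg (lam k)) (sq_nonneg (X c k r).1)])
      h0T ht
    rw [(hsol k).init, sub_zero, Real.norm_eq_abs, Real.norm_eq_abs, abs_of_nonneg ht.1] at h1
    have h2 : |(X c k t).1 - u0 k| ≤ Real.sqrt (B k) :=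
      h1.trans (mul_le_of_le_one_right (Real.sqrt_nonneg _) (ht.2.trans hT1))
    have h3 := (Real.le_sqrt (abs_nonneg _) (hB0 k)).1 h2
    rw [sq_abs] at h3
    nlinarith [sq_nonneg ((X c k t).1 - 2 * u0 k)]
  · refine L2Cont.of_summable_bound hB (fun k => (hcont1 k).const_mul _) fun t ht k => ?_
    rw [mul_pow]
    exact hpot c hc k t ht
  · refine L2Cont.of_summable_bound hB hcontd fun t ht k => ?_
    rw [hd1 k t ht]
    nlinarith [henergy c hc k t ht, mul_nonneg (sq_nonneg (lam k)) (sq_nonneg (X c k t).1)]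
  · refine L2Cont.of_summable_bound hBα (fun k => (hcont1 k).const_mul _) fun t ht k => ?_
    rw [hlamα', mul_assoc, mul_pow, hlamα, mul_pow]
    have := Real.rpow_nonneg (hlam k) (4 * α)
    gcongr
    exact hpot c hc k t ht
  · refine L2Cont.of_summable_bound hBα (fun k => (hcontd k).const_mul _) fun t ht k => ?_
    rw [hd1 k t ht, mul_pow, hlamα]
    have := Real.rpow_nonneg (hlam k) (4 * α)
    gcongr
    nlinarith [henergy c hc k t ht, mul_nonneg (sq_nonneg (lam k)) (sq_nonneg (X c k t).1)]
end
end
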